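/- arXiv:1112.4310 — 4 statements merged into one kernel-verified Lean document; each statement's English description precedes it below -/
import Mathlib

section
/- Let S_1 ⊂ S_2 ⊂ ⋯ ⊂ S_N ⊂ I be rectangles with all inclusions strict. Then the set of basic moves belonging to M_{S_1,…,S_N} is the unique minimal Markov basis for the configuration A_{S_1,…,S_N}: it is a Markov basis for A_{S_1,…,S_N}, and every Markov basis for A_{S_1,…,S_N} contains it. -/
open Finset

namespace Paper

abbrev Table (R C : ℕ) := Fin R × Fin C → ℤ

/-- The table with entry 1 in cell `a` and 0 elsewhere. -/
def e {R C : ℕ} (a : Fin R × Fin C) : Table R C := fun p => if p = a then 1 else 0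

/-- The l1-norm of an integer table. -/
def l1 {R C : ℕ} (z : Table R C) : ℤ := ∑ p : Fin R × Fin C, |z p|

/-- The configuration `A_{S_1,…,S_N}` : row sums, column sums and subtable sums. -/
def configMap {R C N : ℕ} (S : Fin N → Finset (Fin R × Fin C)) (z : Table R C) :
    (Fin R → ℤ) × (Fin C → ℤ) × (Fin N → ℤ) :=
  ⟨fun i => ∑ j, z (i, j), fun j => ∑ i, z (i, j), fun n => ∑ p ∈ S n, z p⟩

/-- A move for `A_{S_1,…,S_N}` : an integer table with vanishing row sums,
column sums and subtable sums. -/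
def IsMove {R C N : ℕ} (S : Fin N → Finset (Fin R × Fin C)) (z : Table R C) : Prop :=
  configMap S z = 0

/-- The fiber `F_t` of the configuration `A_{S_1,…,S_N}` : nonnegative integer tables
with prescribed row sums, column sums and subtable sums. -/
def Fiber {R C N : ℕ} (S : Fin N → Finset (Fin R × Fin C))
    (t : (Fin R → ℤ) × (Fin C → ℤ) × (Fin N → ℤ)) : Set (Table R C) :=
  {x | (∀ p, 0 ≤ x p) ∧ configMap S x = t}

/-- `B` is a Markov basis for the configuration `A_{S_1,…,S_N}`. -/
def IsMarkovBasis {R C N : ℕ} (S : Fin N → Finset (Fin R × Fin C))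
    (B : Set (Table R C)) : Prop :=
  B.Finite ∧ (∀ z ∈ B, IsMove S z) ∧ (∀ z ∈ B, -z ∈ B) ∧
    ∀ t, ∀ x ∈ Fiber S t, ∀ y ∈ Fiber S t, x ≠ y →
      ∃ U : ℕ, 0 < U ∧ ∃ zs : Fin U → Table R C,
        (∀ u, zs u ∈ B) ∧ y = x + ∑ u, zs u ∧
        ∀ u : Fin U, (x + ∑ s ∈ Finset.Iic u, zs s) ∈ Fiber S t

/-- `‖x − y‖₁` can be reduced by the set of moves `B` within the fiber `F`. -/
def CanReduce {R C : ℕ} (F : Set (Table R C)) (B : Set (Table R C))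
    (x y : Table R C) : Prop :=
  ∃ τp τm : ℕ, 0 < τp + τm ∧
    ∃ (Bp : Fin τp → Table R C) (Bm : Fin τm → Table R C),
      (∀ s, Bp s ∈ B) ∧ (∀ s, Bm s ∈ B) ∧
      (∀ u : Fin τp, (x + ∑ s ∈ Finset.Iic u, Bp s) ∈ F) ∧
      (∀ u : Fin τm, (y - ∑ s ∈ Finset.Iic u, Bm s) ∈ F) ∧
      l1 (x - y + ∑ s, Bp s + ∑ s, Bm s) < l1 (x - y)

/-- Basic moves (moves of Type I). -/
def IsBasicMove {R C : ℕ} (z : Table R C) : Prop :=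
  ∃ (i i' : Fin R) (j j' : Fin C), i ≠ i' ∧ j ≠ j' ∧
    z = e (i, j) + e (i', j') - e (i', j) - e (i, j')

/-- A rectangle in the set of cells. -/
def IsRectangle {R C : ℕ} (S : Finset (Fin R × Fin C)) : Prop :=
  ∃ (a₁ a₂ : Fin R) (b₁ b₂ : Fin C), a₁ < a₂ ∧ b₁ < b₂ ∧
    S = Finset.univ.filter fun p => a₁ ≤ p.1 ∧ p.1 ≤ a₂ ∧ b₁ ≤ p.2 ∧ p.2 ≤ b₂

/-- The positive part `z⁺` of a move. -/
def posPart {R C : ℕ} (z : Table R C) : Table R C := fun p => max (z p) 0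

/-- The negative part `z⁻` of a move. -/
def negPart {R C : ℕ} (z : Table R C) : Table R C := fun p => max (-z p) 0

/-- The `(k,l)` block `I_{kl}` (cells are 1-indexed in the paper, hence the `+ 1`). -/
def block {R C : ℕ} (rr cc : ℕ → ℕ) (k l : ℕ) : Finset (Fin R × Fin C) :=
  Finset.univ.filter fun p =>
    rr k ≤ p.1.1 + 1 ∧ p.1.1 + 1 < rr (k+1) ∧ cc l ≤ p.2.1 + 1 ∧ p.2.1 + 1 < cc (l+1)

/-- `S = I_{11} ∪ I_{22} ∪ ⋯ ∪ I_{NN}` : the union of the diagonal blocks. -/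
def Sdiag {R C : ℕ} (N : ℕ) (rr cc : ℕ → ℕ) : Finset (Fin R × Fin C) :=
  (Finset.Icc 1 N).biUnion fun k => block rr cc k k

/-- Two cells lie in a common block `I_{kl}` with `1 ≤ k,l ≤ Nb`. -/
def SameBlock {R C : ℕ} (Nb : ℕ) (rr cc : ℕ → ℕ) (p q : Fin R × Fin C) : Prop :=
  ∃ k l, 1 ≤ k ∧ k ≤ Nb ∧ 1 ≤ l ∧ l ≤ Nb ∧
    p ∈ block (R := R) (C := C) rr cc k l ∧ q ∈ block rr cc k l

/-- Two row indices lie in a common row block `[r_k, r_{k+1})`. -/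
def SameRowBlock {R : ℕ} (Nb : ℕ) (rr : ℕ → ℕ) (i i' : Fin R) : Prop :=
  ∃ k, 1 ≤ k ∧ k ≤ Nb ∧ rr k ≤ i.1 + 1 ∧ i.1 + 1 < rr (k+1) ∧
    rr k ≤ i'.1 + 1 ∧ i'.1 + 1 < rr (k+1)

/-- Moves of Type II: a degree-3 square-free move whose six nonzero cells
lie outside `S` and in six pairwise distinct blocks.  `Nd` bounds the index of the
diagonal blocks of `S`, `Nb` bounds the block indices. -/
def IsTypeII {R C : ℕ} (Nd Nb : ℕ) (rr cc : ℕ → ℕ) (z : Table R C) : Prop :=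
  ∃ (i₁ i₂ i₃ : Fin R) (j₁ j₂ j₃ : Fin C),
    z = e (i₁,j₂) + e (i₂,j₃) + e (i₃,j₁) - e (i₁,j₃) - e (i₂,j₁) - e (i₃,j₂) ∧
    (∀ p ∈ ([(i₁,j₂),(i₂,j₃),(i₃,j₁),(i₁,j₃),(i₂,j₁),(i₃,j₂)] : List (Fin R × Fin C)),
      p ∉ Sdiag Nd rr cc) ∧
    List.Pairwise (fun p q => ¬ SameBlock Nb rr cc p q)
      [(i₁,j₂),(i₂,j₃),(i₃,j₁),(i₁,j₃),(i₂,j₁),(i₃,j₂)]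

/-- Moves of Type III. -/
def IsTypeIII {R C : ℕ} (Nd Nb : ℕ) (rr cc : ℕ → ℕ) (z : Table R C) : Prop :=
  ∃ (i₁ i₂ i₃ : Fin R) (j₁ j₂ j₃ : Fin C),
    z = e (i₁,j₁) + e (i₂,j₃) + e (i₃,j₂) - e (i₁,j₃) - e (i₂,j₂) - e (i₃,j₁) ∧
    (∃ k l, 1 ≤ k ∧ k ≤ Nd ∧ 1 ≤ l ∧ l ≤ Nd ∧ k ≠ l ∧
      (i₁,j₁) ∈ block (R := R) (C := C) rr cc k k ∧ (i₂,j₂) ∈ block rr cc l l) ∧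
    (∀ p ∈ ([(i₂,j₃),(i₃,j₂),(i₁,j₃),(i₃,j₁)] : List (Fin R × Fin C)),
      p ∉ Sdiag Nd rr cc) ∧
    List.Pairwise (fun p q => ¬ SameBlock Nb rr cc p q) [(i₂,j₃),(i₃,j₂),(i₁,j₃),(i₃,j₁)]

/-- Moves of Type IV (row version). -/
def IsTypeIVrow {R C : ℕ} (Nd Nb : ℕ) (rr cc : ℕ → ℕ) (z : Table R C) : Prop :=
  ∃ (i₁ i₂ i₃ i₄ : Fin R) (j₁ j₂ j₃ j₄ : Fin C),
    z = e (i₁,j₁) + e (i₂,j₂) + e (i₃,j₃) + e (i₄,j₄)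
        - e (i₁,j₃) - e (i₂,j₄) - e (i₃,j₂) - e (i₄,j₁) ∧
    (∃ k l, 1 ≤ k ∧ k ≤ Nd ∧ 1 ≤ l ∧ l ≤ Nd ∧ k ≠ l ∧
      (i₁,j₁) ∈ block (R := R) (C := C) rr cc k k ∧ (i₃,j₂) ∈ block rr cc l l) ∧
    (∀ p ∈ ([(i₂,j₂),(i₃,j₃),(i₄,j₄),(i₁,j₃),(i₂,j₄),(i₄,j₁)] : List (Fin R × Fin C)),
      p ∉ Sdiag Nd rr cc) ∧
    SameRowBlock Nb rr i₁ i₂ ∧ SameRowBlock Nb rr i₃ i₄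

/-- Moves of Type IV, including the transposes of the row-version moves. -/
def IsTypeIV {R C : ℕ} (Nd Nb : ℕ) (rr cc : ℕ → ℕ) (z : Table R C) : Prop :=
  IsTypeIVrow Nd Nb rr cc z ∨
    IsTypeIVrow (R := C) (C := R) Nd Nb cc rr (fun p => z (p.2, p.1))

lemma exists_level {N : ℕ} (P : Fin N → Prop) (hP : ∀ n m, n ≤ m → P n → P m) :
    ∃ k : ℕ, k ≤ N ∧ ∀ n : Fin N, P n ↔ k ≤ n.1 := by
  classical
  have hex : ∃ k : ℕ, ∀ n : Fin N, k ≤ n.1 → P n := ⟨N, fun n hn => by have := n.2; omega⟩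
  refine ⟨Nat.find hex, Nat.find_min' hex (fun n hn => by have := n.2; omega), fun n => ⟨fun h => ?_, fun h => Nat.find_spec hex n h⟩⟩
  exact Nat.find_min' hex (fun m hm => hP n m hm h)

lemma sum_Iic_fin {M : Type*} [AddCommMonoid M] {U : ℕ} (F : ℕ → M) (u : Fin U) :
    ∑ s ∈ Finset.Iic u, F s.1 = ∑ k ∈ Finset.range (u.1 + 1), F k := by
  refine Finset.sum_bij (fun s _ => s.1) ?_ ?_ ?_ ?_
  · intro a ha
    have := Finset.mem_Iic.1 ha
    simp only [Finset.mem_range]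
    have h : a.1 ≤ u.1 := this
    omega
  · intro a _ b _ h
    exact Fin.ext h
  · intro b hb
    have := Finset.mem_range.1 hb
    exact ⟨⟨b, by omega⟩, Finset.mem_Iic.2 (by show b ≤ u.1; omega), rfl⟩
  · intro a _; rfl

/-- level of a cell -/
def lev {R C : ℕ} (α : Fin R → ℕ) (β : Fin C → ℕ) (p : Fin R × Fin C) : ℕ :=
  max (α p.1) (β p.2)

/-- level-compatible swap -/
def LC {R C : ℕ} (α : Fin R → ℕ) (β : Fin C → ℕ) (i i' : Fin R) (j j' : Fin C) : Prop :=
  ∀ f : ℕ → ℤ, f (lev α β (i, j)) + f (lev α β (i', j'))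
    = f (lev α β (i', j)) + f (lev α β (i, j'))

def Step {R C : ℕ} (α : Fin R → ℕ) (β : Fin C → ℕ) (x y : Table R C) : Prop :=
  (∀ p, 0 ≤ x p) ∧ (∀ p, 0 ≤ y p) ∧ ∃ i i' j j', i ≠ i' ∧ j ≠ j' ∧ LC α β i i' j j' ∧
    y = x - e (i, j) - e (i', j') + e (i', j) + e (i, j')

abbrev Conn {R C : ℕ} (α : Fin R → ℕ) (β : Fin C → ℕ) (x y : Table R C) : Prop :=
  Relation.ReflTransGen (Step α β) x y

def Same {R C : ℕ} (α : Fin R → ℕ) (β : Fin C → ℕ) (x y : Table R C) : Prop :=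
  ∀ (r : Fin R → ℤ) (c : Fin C → ℤ) (f : ℕ → ℤ),
    ∑ p, x p * (r p.1 + c p.2 + f (lev α β p)) = ∑ p, y p * (r p.1 + c p.2 + f (lev α β p))

section
variable {R C : ℕ} {α : Fin R → ℕ} {β : Fin C → ℕ}

lemma sum_e_mul (a : Fin R × Fin C) (g : Fin R × Fin C → ℤ) :
    ∑ p, e a p * g p = g a := by
  simp [e]

lemma Step.symm {x y : Table R C} (h : Step α β x y) : Step α β y x := by
  obtain ⟨hx, hy, i, i', j, j', hi, hj, hl, rfl⟩ := h
  refine ⟨hy, hx, i', i, j, j', hi.symm, hj, fun f => (hl f).symm, ?_⟩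
  abel

lemma Step.sum_eq {x y : Table R C} (h : Step α β x y) : Same α β x y := by
  obtain ⟨hx, hy, i, i', j, j', hi, hj, hl, rfl⟩ := h
  intro r c f
  simp only [Pi.add_apply, Pi.sub_apply, add_mul _ _ (_ : ℤ), sub_mul, Finset.sum_add_distrib,
    Finset.sum_sub_distrib, sum_e_mul]
  have := hl f
  linarith

lemma Same.symm {x y : Table R C} (h : Same α β x y) : Same α β y x :=
  fun r c f => (h r c f).symm

lemma Same.trans {x y z : Table R C} (h : Same α β x y) (h' : Same α β y z) : Same α β x z :=
  fun r c f => (h r c f).trans (h' r c f)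

lemma Conn.symm {x y : Table R C} (h : Conn α β x y) : Conn α β y x := by
  induction h with
  | refl => exact .refl
  | tail _ h ih => exact .head h.symm ih

lemma Conn.same {x y : Table R C} (h : Conn α β x y) : Same α β x y := by
  induction h with
  | refl => exact fun _ _ _ => rfl
  | tail _ h ih => exact ih.trans h.sum_eq

lemma Conn.nonneg {x y : Table R C} (h : Conn α β x y) (hx : ∀ p, 0 ≤ x p) : ∀ p, 0 ≤ y p := by
  induction h with
  | refl => exact hx
  | tail _ h ih => exact h.2.1

lemma e_nonneg (a p : Fin R × Fin C) : 0 ≤ e a p := by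
  unfold e; split <;> norm_num

lemma Conn.add_e {x y : Table R C} (a : Fin R × Fin C) (h : Conn α β x y) :
    Conn α β (x + e a) (y + e a) := by
  have key : ∀ u v : Table R C, Step α β u v → Step α β (u + e a) (v + e a) := by
    rintro x y ⟨hx, hy, i, i', j, j', hi, hj, hl, rfl⟩
    refine ⟨fun p => add_nonneg (hx p) (e_nonneg a p), fun p => add_nonneg (hy p) (e_nonneg a p),
      i, i', j, j', hi, hj, hl, ?_⟩
    abel
  induction h with
  | refl => exact .refl
  | tail _ h ih => exact .tail ih (key _ _ h)

lemma step_of_pos {x : Table R C} (hx : ∀ p, 0 ≤ x p) {i i' : Fin R} {j j' : Fin C}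
    (hi : i ≠ i') (hj : j ≠ j') (h1 : 0 < x (i, j)) (h2 : 0 < x (i', j'))
    (hl : LC α β i i' j j') :
    Step α β x (x - e (i, j) - e (i', j') + e (i', j) + e (i, j')) := by
  refine ⟨hx, fun p => ?_, i, i', j, j', hi, hj, hl, rfl⟩
  have h3 := e_nonneg (i', j) p
  have h4 := e_nonneg (i, j') p
  have h0 := hx p
  simp only [Pi.add_apply, Pi.sub_apply]
  by_cases ha : p = (i, j)
  · subst ha
    have : e (i', j') (i, j) = 0 := by simp [e, hi]
    have : e (i, j) (i, j) = 1 := by simp [e]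
    omega
  · have h5 : e (i, j) p = 0 := by simp [e, ha]
    by_cases hb : p = (i', j')
    · subst hb
      have : e (i', j') (i', j') = 1 := by simp [e]
      omega
    · have : e (i', j') p = 0 := by simp [e, hb]
      omega

lemma swap_pos {x : Table R C} (hx : ∀ p, 0 ≤ x p) {i i' : Fin R} {j j' : Fin C}
    (h1 : 0 < x (i, j)) (h2 : 0 < x (i', j')) (hl : LC α β i i' j j') :
    ∃ y, Conn α β x y ∧ 0 < y (i', j) ∧ 0 < y (i, j') := by
  by_cases hi : i = i'
  · subst hi; exact ⟨x, .refl, h1, h2⟩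
  by_cases hj : j = j'
  · subst hj; exact ⟨x, .refl, h2, h1⟩
  refine ⟨_, .single (step_of_pos hx hi hj h1 h2 hl), ?_, ?_⟩
  · have := hx (i', j)
    have := e_nonneg (i, j') (i', j)
    have : e (i', j) (i', j) = 1 := by simp [e]
    have : e (i, j) (i', j) = 0 := by simp [e, Ne.symm hi]
    have : e (i', j') (i', j) = 0 := by simp [e, hj]
    simp only [Pi.add_apply, Pi.sub_apply]
    omega
  · have := hx (i, j')
    have := e_nonneg (i', j) (i, j')
    have : e (i, j') (i, j') = 1 := by simp [e]
    have : e (i, j) (i, j') = 0 := by simp [e, Ne.symm hj]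
    have : e (i', j') (i, j') = 0 := by simp [e, hi]
    simp only [Pi.add_apply, Pi.sub_apply]
    omega

/-- weighted mass on a set of cells -/
def mass (x : Table R C) (P : Fin R × Fin C → Prop) [DecidablePred P] : ℤ :=
  ∑ p, x p * (if P p then 1 else 0)

lemma mass_nonneg {x : Table R C} (hx : ∀ p, 0 ≤ x p) (P : Fin R × Fin C → Prop)
    [DecidablePred P] : 0 ≤ mass x P :=
  Finset.sum_nonneg fun p _ => mul_nonneg (hx p) (by split <;> norm_num)

lemma mass_pos {x : Table R C} (hx : ∀ p, 0 ≤ x p) (P : Fin R × Fin C → Prop)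
    [DecidablePred P] (p : Fin R × Fin C) (h : 0 < x p) (hp : P p) : 0 < mass x P := by
  refine Finset.sum_pos' (fun p _ => mul_nonneg (hx p) (by split <;> norm_num)) ⟨p, by simp, ?_⟩
  simp [hp, h]

lemma exists_of_mass_pos {x : Table R C} (hx : ∀ p, 0 ≤ x p) (P : Fin R × Fin C → Prop)
    [DecidablePred P] (h : 0 < mass x P) : ∃ p, 0 < x p ∧ P p := by
  obtain ⟨p, -, hp⟩ := Finset.exists_lt_of_sum_lt (s := Finset.univ) (f := fun _ => (0:ℤ))
    (g := fun p => x p * (if P p then 1 else 0)) (by simpa [mass] using h)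
  refine ⟨p, ?_⟩
  by_cases hP : P p
  · simpa [hP] using hp
  · simp [hP] at hp

lemma Same.row {x y : Table R C} (h : Same α β x y) (hx : ∀ p, 0 ≤ x p) (hy : ∀ p, 0 ≤ y p)
    {i : Fin R} {j : Fin C} (hp : 0 < y (i, j)) : ∃ j', 0 < x (i, j') := by
  have h1 := mass_pos hy (fun p => p.1 = i) (i, j) hp rfl
  have h2 := h (fun a => if a = i then 1 else 0) 0 0
  simp only [Pi.zero_apply, add_zero] at h2
  obtain ⟨⟨a, b⟩, h3, rfl⟩ := exists_of_mass_pos hx (fun p => p.1 = i) (by unfold mass at *; exact h2 ▸ h1)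
  exact ⟨b, h3⟩

lemma Same.col {x y : Table R C} (h : Same α β x y) (hx : ∀ p, 0 ≤ x p) (hy : ∀ p, 0 ≤ y p)
    {i : Fin R} {j : Fin C} (hp : 0 < y (i, j)) : ∃ i', 0 < x (i', j) := by
  have h1 := mass_pos hy (fun p => p.2 = j) (i, j) hp rfl
  have h2 := h 0 (fun a => if a = j then 1 else 0) 0
  simp only [Pi.zero_apply, add_zero, zero_add] at h2
  obtain ⟨⟨a, b⟩, h3, rfl⟩ := exists_of_mass_pos hx (fun p => p.2 = j) (by unfold mass at *; exact h2 ▸ h1)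
  exact ⟨a, h3⟩

/-- block lemma -/
lemma block_common {x y : Table R C} (h : Same α β x y) (hx : ∀ p, 0 ≤ x p)
    (hy : ∀ p, 0 ≤ y p) {i i' : Fin R} {j j' : Fin C} (h1 : 0 < x (i, j)) (h2 : 0 < y (i', j'))
    (hα : α i = α i') (hβ : β j = β j') : ∃ x', Conn α β x x' ∧ 0 < x' (i', j') := by
  obtain ⟨j₂, h3⟩ := h.row hx hy h2
  obtain ⟨x₁, hc₁, h4, -⟩ := swap_pos (α := α) (β := β) hx h1 h3
    (fun f => by simp only [lev, hα])
  have hx₁ := hc₁.nonneg hx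
  obtain ⟨i₂, h5⟩ := (hc₁.same.symm.trans h).col hx₁ hy h2
  obtain ⟨x₂, hc₂, -, h6⟩ := swap_pos (α := α) (β := β) hx₁ h4 h5
    (fun f => by simp only [lev, hβ]; ring)
  exact ⟨x₂, hc₁.trans hc₂, h6⟩

/-- no throughput -/
def Nice (α : Fin R → ℕ) (β : Fin C → ℕ) (x : Table R C) : Prop :=
  (∀ i j i' j', 0 < x (i, j) → 0 < x (i', j') → α i < β j → β j = α i' → α i' < β j' → False) ∧
  (∀ i j i' j', 0 < x (i, j) → 0 < x (i', j') → β j < α i → α i = β j' → β j' < α i' → False)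

lemma mass_step {x : Table R C} (P : Fin R × Fin C → Prop) [DecidablePred P]
    (i i' : Fin R) (j j' : Fin C) :
    mass (x - e (i, j) - e (i', j') + e (i', j) + e (i, j')) P =
      mass x P - (if P (i, j) then 1 else 0) - (if P (i', j') then 1 else 0)
        + (if P (i', j) then 1 else 0) + (if P (i, j') then 1 else 0) := by
  simp only [mass, Pi.add_apply, Pi.sub_apply, add_mul _ _ (_ : ℤ), sub_mul,
    Finset.sum_add_distrib, Finset.sum_sub_distrib, sum_e_mul]

lemma exists_nice_aux (k : ℕ) : ∀ x : Table R C, (∀ p, 0 ≤ x p) →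
    mass x (fun p => α p.1 ≠ β p.2) ≤ k → ∃ y, Conn α β x y ∧ Nice α β y := by
  induction k with
  | zero =>
    intro x hx hk
    refine ⟨x, .refl, ?_, ?_⟩
    · intro i j i' j' h1 _ h3 _ _
      have := mass_pos hx (fun p => α p.1 ≠ β p.2) (i, j) h1 (by simp only; omega)
      push_cast at hk; omega
    · intro i j i' j' h1 _ h3 _ _
      have := mass_pos hx (fun p => α p.1 ≠ β p.2) (i, j) h1 (by simp only; omega)
      push_cast at hk; omega
  | succ k ih =>
    intro x hx hk
    by_cases hn : Nice α β x
    · exact ⟨x, .refl, hn⟩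
    have key : ∃ i i' j j', 0 < x (i, j) ∧ 0 < x (i', j') ∧ i ≠ i' ∧ j ≠ j' ∧ LC α β i i' j j' ∧
        α i ≠ β j ∧ α i' ≠ β j' ∧ (α i' = β j ∨ α i = β j') := by
      by_contra hne
      apply hn
      constructor
      · intro i j i' j' h1 h2 h3 h4 h5
        refine hne ⟨i, i', j, j', h1, h2, ?_, ?_, ?_, by omega, by omega, by omega⟩
        · rintro rfl; omega
        · rintro rfl; omega
        · intro f
          simp only [lev]
          rw [max_eq_right h3.le, max_eq_right h5.le, max_eq_left h4.le,
            max_eq_right (by omega : α i ≤ β j'), h4]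
      · intro i j i' j' h1 h2 h3 h4 h5
        refine hne ⟨i, i', j, j', h1, h2, ?_, ?_, ?_, by omega, by omega, by omega⟩
        · rintro rfl; omega
        · rintro rfl; omega
        · intro f
          simp only [lev]
          rw [max_eq_left h3.le, max_eq_left h5.le, max_eq_left h4.ge,
            max_eq_left (by omega : β j ≤ α i')]
          ring
    obtain ⟨i, i', j, j', h1, h2, hi, hj, hl, n1, n2, n3⟩ := key
    have hs := step_of_pos hx hi hj h1 h2 hl
    obtain ⟨y, hy, hny⟩ := ih _ hs.2.1 (by
      rw [mass_step]
      simp only [if_pos n1, if_pos n2]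
      generalize mass x (fun p => α p.1 ≠ β p.2) = M at *
      push_cast at hk
      rcases n3 with n3 | n3
      · simp only [n3, ne_eq, not_true_eq_false, if_false]; split_ifs <;> omega
      · simp only [n3, ne_eq, not_true_eq_false, if_false]; split_ifs <;> omega)
    exact ⟨y, .head hs hy, hny⟩

lemma exists_nice (x : Table R C) (hx : ∀ p, 0 ≤ x p) : ∃ y, Conn α β x y ∧ Nice α β y :=
  exists_nice_aux (mass x (fun p => α p.1 ≠ β p.2)).toNat x hx (Int.self_le_toNat _)

lemma Same.upper {x y : Table R C} (h : Same α β x y) (n : ℕ) :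
    mass x (fun p => α p.1 < n ∧ β p.2 = n) - mass x (fun p => α p.1 = n ∧ n < β p.2) =
    mass y (fun p => α p.1 < n ∧ β p.2 = n) - mass y (fun p => α p.1 = n ∧ n < β p.2) := by
  have := h (fun i => - if α i = n then 1 else 0) 0 (fun m => if m = n then 1 else 0)
  simp only [mass, ← Finset.sum_sub_distrib, ← mul_sub]
  convert this using 3 with p _ p _ <;>
  · simp only [lev, Pi.zero_apply]
    split_ifs <;> omega

lemma Same.lower {x y : Table R C} (h : Same α β x y) (n : ℕ) :
    mass x (fun p => β p.2 < n ∧ α p.1 = n) - mass x (fun p => β p.2 = n ∧ n < α p.1) =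
    mass y (fun p => β p.2 < n ∧ α p.1 = n) - mass y (fun p => β p.2 = n ∧ n < α p.1) := by
  have := h 0 (fun i => - if β i = n then 1 else 0) (fun m => if m = n then 1 else 0)
  simp only [mass, ← Finset.sum_sub_distrib, ← mul_sub]
  convert this using 3 with p _ p _ <;>
  · simp only [lev, Pi.zero_apply]
    split_ifs <;> omega

lemma Same.diag {x y : Table R C} (h : Same α β x y) (n : ℕ) :
    mass x (fun p => α p.1 < n ∧ β p.2 = n) + mass x (fun p => β p.2 < n ∧ α p.1 = n)
      + mass x (fun p => α p.1 = n ∧ β p.2 = n) =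
    mass y (fun p => α p.1 < n ∧ β p.2 = n) + mass y (fun p => β p.2 < n ∧ α p.1 = n)
      + mass y (fun p => α p.1 = n ∧ β p.2 = n) := by
  have := h 0 0 (fun m => if m = n then 1 else 0)
  simp only [mass, ← Finset.sum_add_distrib, ← mul_add]
  convert this using 3 with p _ p _ <;>
  · simp only [lev, Pi.zero_apply]
    split_ifs <;> omega

lemma Nice.upper {x : Table R C} (h : Nice α β x) (hx : ∀ p, 0 ≤ x p) (n : ℕ) :
    mass x (fun p => α p.1 < n ∧ β p.2 = n) = 0 ∨ mass x (fun p => α p.1 = n ∧ n < β p.2) = 0 := by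
  by_contra! hne
  have n1 := mass_nonneg hx (fun p => α p.1 < n ∧ β p.2 = n)
  have n2 := mass_nonneg hx (fun p => α p.1 = n ∧ n < β p.2)
  obtain ⟨⟨i, j⟩, h1, h2, h3⟩ := exists_of_mass_pos hx _ (lt_of_le_of_ne n1 hne.1.symm)
  obtain ⟨⟨i', j'⟩, h1', h2', h3'⟩ := exists_of_mass_pos hx _ (lt_of_le_of_ne n2 hne.2.symm)
  simp only at *
  exact h.1 i j i' j' h1 h1' (by omega) (by omega) (by omega)

lemma Nice.lower {x : Table R C} (h : Nice α β x) (hx : ∀ p, 0 ≤ x p) (n : ℕ) :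
    mass x (fun p => β p.2 < n ∧ α p.1 = n) = 0 ∨ mass x (fun p => β p.2 = n ∧ n < α p.1) = 0 := by
  by_contra! hne
  have n1 := mass_nonneg hx (fun p => β p.2 < n ∧ α p.1 = n)
  have n2 := mass_nonneg hx (fun p => β p.2 = n ∧ n < α p.1)
  obtain ⟨⟨i, j⟩, h1, h2, h3⟩ := exists_of_mass_pos hx _ (lt_of_le_of_ne n1 hne.1.symm)
  obtain ⟨⟨i', j'⟩, h1', h2', h3'⟩ := exists_of_mass_pos hx _ (lt_of_le_of_ne n2 hne.2.symm)
  simp only at *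
  exact h.2 i j i' j' h1 h1' (by omega) (by omega) (by omega)

lemma common_cell {x y : Table R C} (h : Same α β x y) (hx : ∀ p, 0 ≤ x p)
    (hy : ∀ p, 0 ≤ y p) (nx : Nice α β x) (ny : Nice α β y) (hne : ∃ p, 0 < y p) :
    ∃ x' p, Conn α β x x' ∧ 0 < x' p ∧ 0 < y p := by
  classical
  have hU : ∀ n, mass x (fun p => α p.1 < n ∧ β p.2 = n) = mass y (fun p => α p.1 < n ∧ β p.2 = n) ∧
      mass x (fun p => α p.1 = n ∧ n < β p.2) = mass y (fun p => α p.1 = n ∧ n < β p.2) := by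
    intro n
    have := h.upper n
    have := nx.upper hx n
    have := ny.upper hy n
    have := mass_nonneg hx (fun p => α p.1 < n ∧ β p.2 = n)
    have := mass_nonneg hx (fun p => α p.1 = n ∧ n < β p.2)
    have := mass_nonneg hy (fun p => α p.1 < n ∧ β p.2 = n)
    have := mass_nonneg hy (fun p => α p.1 = n ∧ n < β p.2)
    omega
  have hL : ∀ n, mass x (fun p => β p.2 < n ∧ α p.1 = n) = mass y (fun p => β p.2 < n ∧ α p.1 = n) ∧
      mass x (fun p => β p.2 = n ∧ n < α p.1) = mass y (fun p => β p.2 = n ∧ n < α p.1) := by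
    intro n
    have := h.lower n
    have := nx.lower hx n
    have := ny.lower hy n
    have := mass_nonneg hx (fun p => β p.2 < n ∧ α p.1 = n)
    have := mass_nonneg hx (fun p => β p.2 = n ∧ n < α p.1)
    have := mass_nonneg hy (fun p => β p.2 < n ∧ α p.1 = n)
    have := mass_nonneg hy (fun p => β p.2 = n ∧ n < α p.1)
    omega
  obtain ⟨⟨i, j⟩, hp⟩ := hne
  rcases lt_trichotomy (α i) (β j) with hlt | heq | hgt
  · -- upper
    have hex : ∃ n, 0 < mass y (fun p => α p.1 < n ∧ β p.2 = n) :=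
      ⟨β j, mass_pos hy _ (i, j) hp ⟨hlt, rfl⟩⟩
    obtain ⟨b, hb, hmin⟩ : ∃ b, 0 < mass y (fun p => α p.1 < b ∧ β p.2 = b) ∧
        ∀ m < b, ¬ 0 < mass y (fun p => α p.1 < m ∧ β p.2 = m) :=
      ⟨Nat.find hex, Nat.find_spec hex, fun m hm => Nat.find_min hex hm⟩
    obtain ⟨⟨i₂, j₂⟩, h2, h3, h4⟩ := exists_of_mass_pos hy _ hb
    obtain ⟨⟨i₁, j₁⟩, h5, h6, h7⟩ := exists_of_mass_pos hx _ (by rw [(hU b).1]; exact hb)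
    have h8 := mass_pos hy (fun p => α p.1 = α i₂ ∧ α i₂ < β p.2) (i₂, j₂) h2
      ⟨rfl, by simp only at *; omega⟩
    rw [← (hU (α i₂)).2] at h8
    obtain ⟨⟨i₃, j₃⟩, h9, h10, h11⟩ := exists_of_mass_pos hx _ h8
    simp only at *
    have h12 : b ≤ β j₃ := by
      by_contra! hlt
      refine hmin _ hlt ?_
      rw [← (hU _).1]
      exact mass_pos hx _ (i₃, j₃) h9 ⟨by simp only; omega, rfl⟩
    obtain ⟨x₁, hc, h13, -⟩ := swap_pos (α := α) (β := β) hx h5 h9 (fun f => by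
      simp only [lev]
      rw [max_eq_right (by omega : α i₁ ≤ β j₁), max_eq_right (by omega : α i₃ ≤ β j₃),
        max_eq_right (by omega : α i₃ ≤ β j₁), max_eq_right (by omega : α i₁ ≤ β j₃)])
    obtain ⟨x₂, hc', h14⟩ := block_common (hc.same.symm.trans h) (hc.nonneg hx) hy h13 h2
      (by omega) (by omega)
    exact ⟨x₂, _, hc.trans hc', h14, h2⟩
  · have h1 := mass_pos hy (fun p => α p.1 = α i ∧ β p.2 = α i) (i, j) hp ⟨rfl, heq.symm⟩
    have h2 := h.diag (α i)
    rw [(hU (α i)).1, (hL (α i)).1] at h2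
    obtain ⟨⟨i₁, j₁⟩, h5, h6, h7⟩ := exists_of_mass_pos hx
      (fun p => α p.1 = α i ∧ β p.2 = α i) (by omega)
    simp only at *
    obtain ⟨x₂, hc', h14⟩ := block_common h hx hy h5 hp (by omega) (by omega)
    exact ⟨x₂, _, hc', h14, hp⟩
  · have hex : ∃ n, 0 < mass y (fun p => β p.2 < n ∧ α p.1 = n) :=
      ⟨α i, mass_pos hy _ (i, j) hp ⟨hgt, rfl⟩⟩
    obtain ⟨b, hb, hmin⟩ : ∃ b, 0 < mass y (fun p => β p.2 < b ∧ α p.1 = b) ∧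
        ∀ m < b, ¬ 0 < mass y (fun p => β p.2 < m ∧ α p.1 = m) :=
      ⟨Nat.find hex, Nat.find_spec hex, fun m hm => Nat.find_min hex hm⟩
    obtain ⟨⟨i₂, j₂⟩, h2, h3, h4⟩ := exists_of_mass_pos hy _ hb
    obtain ⟨⟨i₁, j₁⟩, h5, h6, h7⟩ := exists_of_mass_pos hx _ (by rw [(hL b).1]; exact hb)
    have h8 := mass_pos hy (fun p => β p.2 = β j₂ ∧ β j₂ < α p.1) (i₂, j₂) h2
      ⟨rfl, by simp only at *; omega⟩
    rw [← (hL (β j₂)).2] at h8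
    obtain ⟨⟨i₃, j₃⟩, h9, h10, h11⟩ := exists_of_mass_pos hx _ h8
    simp only at *
    have h12 : b ≤ α i₃ := by
      by_contra! hlt
      refine hmin _ hlt ?_
      rw [← (hL _).1]
      exact mass_pos hx _ (i₃, j₃) h9 ⟨by simp only; omega, rfl⟩
    obtain ⟨x₁, hc, -, h13⟩ := swap_pos (α := α) (β := β) hx h5 h9 (fun f => by
      simp only [lev]
      rw [max_eq_left (by omega : β j₁ ≤ α i₁), max_eq_left (by omega : β j₃ ≤ α i₃),
        max_eq_left (by omega : β j₁ ≤ α i₃), max_eq_left (by omega : β j₃ ≤ α i₁)]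
      ring)
    obtain ⟨x₂, hc', h14⟩ := block_common (hc.same.symm.trans h) (hc.nonneg hx) hy h13 h2
      (by omega) (by omega)
    exact ⟨x₂, _, hc.trans hc', h14, h2⟩

lemma Same.total {x y : Table R C} (h : Same α β x y) : ∑ p, x p = ∑ p, y p := by
  simpa using h 1 0 0

lemma sub_e_nonneg {x : Table R C} (hx : ∀ p, 0 ≤ x p) {a : Fin R × Fin C} (h : 0 < x a) :
    ∀ p, 0 ≤ (x - e a) p := by
  intro p
  have := hx p
  simp only [Pi.sub_apply, e]
  split_ifs with hp
  · subst hp; omega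
  · omega

lemma conn_of_same (k : ℕ) : ∀ x y : Table R C, (∀ p, 0 ≤ x p) → (∀ p, 0 ≤ y p) →
    Same α β x y → ∑ p, x p = k → Conn α β x y := by
  induction k with
  | zero =>
    intro x y hx hy h hk
    have hk' := h.total ▸ hk
    have h1 := (Finset.sum_eq_zero_iff_of_nonneg (fun p _ => hx p)).1 (by simpa using hk)
    have h2 := (Finset.sum_eq_zero_iff_of_nonneg (fun p _ => hy p)).1 (by simpa using hk')
    have : x = y := by
      ext p; rw [h1 p (by simp), h2 p (by simp)]
    rw [this]
  | succ k ih =>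
    intro x y hx hy h hk
    obtain ⟨x', hcx, nx⟩ := exists_nice (α := α) (β := β) x hx
    obtain ⟨y', hcy, ny⟩ := exists_nice (α := α) (β := β) y hy
    have hx' := hcx.nonneg hx
    have hy' := hcy.nonneg hy
    have h' : Same α β x' y' := (hcx.same.symm.trans h).trans hcy.same
    have htot : ∑ p, y' p = (k + 1 : ℕ) := by rw [← h'.total, ← hcx.same.total, hk]
    have hne : ∃ p, 0 < y' p := by
      by_contra! hc
      have := Finset.sum_nonpos (s := Finset.univ) (fun p _ => hc p)
      push_cast at htot
      omega
    obtain ⟨x'', p, hc, hp1, hp2⟩ := common_cell h' hx' hy' nx ny hne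
    have hx'' := hc.nonneg hx'
    have h'' := hc.same.symm.trans h'
    have hs : Same α β (x'' - e p) (y' - e p) := by
      intro r c f
      simp only [Pi.sub_apply, sub_mul, Finset.sum_sub_distrib]
      rw [h'' r c f]
    have ht : ∑ q, (x'' - e p) q = k := by
      have h1 : ∑ q, e p q = 1 := by simp [e]
      simp only [Pi.sub_apply, Finset.sum_sub_distrib]
      rw [h1, h''.total, htot]
      push_cast; ring
    have := (ih _ _ (sub_e_nonneg hx'' hp1) (sub_e_nonneg hy' hp2) hs ht).add_e p
    rw [sub_add_cancel, sub_add_cancel] at this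
    exact ((hcx.trans hc).trans this).trans hcy.symm

lemma Conn.path {x y : Table R C} (h : Conn α β x y) :
    ∃ (U : ℕ) (g : ℕ → Table R C), g 0 = x ∧ g U = y ∧ ∀ k < U, Step α β (g k) (g (k + 1)) := by
  induction h with
  | refl => exact ⟨0, fun _ => x, rfl, rfl, by simp⟩
  | @tail b c _ h ih =>
    obtain ⟨U, g, h0, hU, hs⟩ := ih
    refine ⟨U + 1, fun n => if n ≤ U then g n else c, by simp [h0], by simp, ?_⟩
    intro k hk
    rcases Nat.lt_or_ge k U with h1 | h1
    · simp only [if_pos h1.le, if_pos (Nat.succ_le_of_lt h1)]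
      exact hs k h1
    · obtain rfl : k = U := by omega
      simp only [le_refl, if_true, hU]
      rw [if_neg (by omega)]
      exact h

lemma configMap_add {N : ℕ} (S : Fin N → Finset (Fin R × Fin C)) (x y : Table R C) :
    configMap S (x + y) = configMap S x + configMap S y := by
  simp only [configMap, Pi.add_apply, Finset.sum_add_distrib]
  rfl

lemma configMap_neg {N : ℕ} (S : Fin N → Finset (Fin R × Fin C)) (x : Table R C) :
    configMap S (-x) = -configMap S x := by
  simp only [configMap, Pi.neg_apply, Finset.sum_neg_distrib]
  rfl

lemma configMap_sub {N : ℕ} (S : Fin N → Finset (Fin R × Fin C)) (x y : Table R C) :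
    configMap S (x - y) = configMap S x - configMap S y := by
  rw [sub_eq_add_neg, configMap_add, configMap_neg, sub_eq_add_neg]

lemma sum_row_e (a : Fin R × Fin C) (i : Fin R) :
    ∑ j, e a (i, j) = if i = a.1 then 1 else 0 := by
  obtain ⟨a, b⟩ := a
  by_cases h : i = a <;> simp [e, h]

lemma sum_col_e (a : Fin R × Fin C) (j : Fin C) :
    ∑ i, e a (i, j) = if j = a.2 then 1 else 0 := by
  obtain ⟨a, b⟩ := a
  by_cases h : j = b <;> simp [e, h]

lemma configMap_eq_of_step {N : ℕ} {S : Fin N → Finset (Fin R × Fin C)}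
    (hS : ∀ n p, p ∈ S n ↔ lev α β p ≤ n.1) {x y : Table R C} (h : Step α β x y) :
    configMap S y = configMap S x := by
  obtain ⟨-, -, i, i', j, j', hi, hj, hl, rfl⟩ := h
  rw [configMap_add, configMap_add, configMap_sub, configMap_sub]
  have : configMap S (e (i', j)) + configMap S (e (i, j'))
      = configMap S (e (i, j)) + configMap S (e (i', j')) := by
    refine Prod.ext ?_ (Prod.ext ?_ ?_)
    · funext a
      simp only [configMap, Prod.fst_add, Pi.add_apply, sum_row_e]
      ring
    · funext a
      simp only [configMap, Prod.fst_add, Prod.snd_add, Pi.add_apply, sum_col_e]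
    · funext n
      have h1 : ∀ a, ∑ p ∈ S n, e a p = if lev α β a ≤ n.1 then 1 else 0 := by
        intro a
        simp [e, hS]
      simp only [configMap, Prod.snd_add, Pi.add_apply, h1]
      have := hl (fun m => if m ≤ n.1 then 1 else 0)
      exact this.symm
  rw [add_assoc, this]
  abel

lemma same_of_config {N : ℕ} {S : Fin N → Finset (Fin R × Fin C)}
    (hS : ∀ n p, p ∈ S n ↔ lev α β p ≤ n.1) (hle : ∀ p, lev α β p ≤ N) {x y : Table R C}
    (h : configMap S x = configMap S y) : Same α β x y := by
  have hz : configMap S (x - y) = 0 := by rw [configMap_sub, h, sub_self]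
  set z := x - y with hzd
  have hrow : ∀ i, ∑ j, z (i, j) = 0 := fun i => congrFun (congrArg Prod.fst hz) i
  have hcol : ∀ j, ∑ i, z (i, j) = 0 := fun j => congrFun (congrArg (fun t => t.2.1) hz) j
  have hsub : ∀ n, ∑ p ∈ S n, z p = 0 := fun n => congrFun (congrArg (fun t => t.2.2) hz) n
  intro r c f
  rw [← sub_eq_zero, ← Finset.sum_sub_distrib]
  have e1 : ∑ p, z p * r p.1 = 0 := by
    rw [Fintype.sum_prod_type]
    refine Finset.sum_eq_zero fun i _ => ?_
    simp only [← Finset.sum_mul, hrow, zero_mul]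
  have e2 : ∑ p, z p * c p.2 = 0 := by
    rw [Fintype.sum_prod_type_right]
    refine Finset.sum_eq_zero fun i _ => ?_
    simp only [← Finset.sum_mul, hcol, zero_mul]
  have e0 : ∑ p, z p = 0 := by
    rw [Fintype.sum_prod_type]
    exact Finset.sum_eq_zero fun i _ => hrow i
  have tel : ∀ M l : ℕ, l ≤ M →
      f l = f M - ∑ n ∈ Finset.range M, (if l ≤ n then f (n + 1) - f n else 0) := by
    intro M
    induction M with
    | zero => intro l hl; simp [Nat.le_zero.1 hl]
    | succ M ih =>
      intro l hl
      rw [Finset.sum_range_succ]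
      rcases Nat.lt_or_ge M l with h1 | h1
      · obtain rfl : l = M + 1 := by omega
        rw [Finset.sum_eq_zero, if_neg (by omega)]
        · ring
        · intro n hn
          rw [if_neg]
          have := Finset.mem_range.1 hn
          omega
      · rw [if_pos h1]
        have := ih l h1
        linarith
  have e3 : ∑ p, z p * f (lev α β p) = 0 := by
    have : ∀ p, z p * f (lev α β p) = z p * f N - ∑ n ∈ Finset.range N,
        (if lev α β p ≤ n then z p else 0) * (f (n + 1) - f n) := by
      intro p
      rw [tel N _ (hle p), mul_sub, Finset.mul_sum]
      congr 1
      refine Finset.sum_congr rfl fun n _ => ?_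
      split_ifs <;> simp
    simp only [this]
    rw [Finset.sum_sub_distrib, ← Finset.sum_mul, e0, Finset.sum_comm, zero_mul, zero_sub,
      neg_eq_zero]
    refine Finset.sum_eq_zero fun n hn => ?_
    rw [← Finset.sum_mul]
    have h2 := hsub ⟨n, Finset.mem_range.1 hn⟩
    have h3 : S ⟨n, Finset.mem_range.1 hn⟩ = Finset.univ.filter (fun p => lev α β p ≤ n) := by
      ext p; simp [hS]
    rw [h3, Finset.sum_filter] at h2
    rw [h2, zero_mul]
  have : ∀ p, x p * (r p.1 + c p.2 + f (lev α β p)) - y p * (r p.1 + c p.2 + f (lev α β p))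
      = z p * r p.1 + z p * c p.2 + z p * f (lev α β p) := by
    intro p; simp only [hzd, Pi.sub_apply]; ring
  simp only [this, Finset.sum_add_distrib, e1, e2, e3, add_zero]

lemma basic_finite : {z : Table R C | IsBasicMove z}.Finite := by
  refine (Set.finite_range (fun q : Fin R × Fin R × Fin C × Fin C =>
    (e (q.1, q.2.2.1) + e (q.2.1, q.2.2.2) - e (q.2.1, q.2.2.1) - e (q.1, q.2.2.2) :
      Table R C))).subset ?_
  rintro z ⟨i, i', j, j', -, -, rfl⟩
  exact ⟨(i, i', j, j'), rfl⟩

lemma markov_main {N : ℕ} {S : Fin N → Finset (Fin R × Fin C)}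
    (hS : ∀ n p, p ∈ S n ↔ lev α β p ≤ n.1) (hle : ∀ p, lev α β p ≤ N) :
    IsMarkovBasis S {z | IsBasicMove z ∧ IsMove S z} := by
  refine ⟨basic_finite.subset fun z hz => hz.1, fun z hz => hz.2, ?_, ?_⟩
  · rintro z ⟨⟨i, i', j, j', hi, hj, rfl⟩, hm⟩
    refine ⟨⟨i', i, j, j', hi.symm, hj, by abel⟩, ?_⟩
    unfold IsMove at *
    rw [configMap_neg, hm, neg_zero]
  · intro t x hx y hy hxy
    have hs : Same α β x y := same_of_config hS hle (hx.2.trans hy.2.symm)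
    have hc : Conn α β x y := conn_of_same (∑ p, x p).toNat x y hx.1 hy.1 hs
      (Int.toNat_of_nonneg (Finset.sum_nonneg fun p _ => hx.1 p)).symm
    obtain ⟨U, g, h0, hU, hst⟩ := hc.path
    have hcfg : ∀ k ≤ U, configMap S (g k) = t := by
      intro k
      induction k with
      | zero => intro _; rw [h0]; exact hx.2
      | succ k ih => intro hk; rw [configMap_eq_of_step hS (hst k hk)]; exact ih (by omega)
    refine ⟨U, ?_, fun u => g (u.1 + 1) - g u.1, ?_, ?_, ?_⟩
    · rcases Nat.eq_zero_or_pos U with rfl | h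
      · exact absurd (h0.symm.trans hU) hxy
      · exact h
    · intro u
      refine ⟨?_, ?_⟩
      · obtain ⟨-, -, i, i', j, j', hi, hj, -, h⟩ := hst u.1 u.2
        refine ⟨i', i, j, j', hi.symm, hj, ?_⟩
        simp only [h]
        abel
      · show configMap S _ = 0
        rw [configMap_sub, configMap_eq_of_step hS (hst u.1 u.2), sub_self]
    · rw [Fin.sum_univ_eq_sum_range (fun k => g (k + 1) - g k), Finset.sum_range_sub, h0, hU]
      abel
    · intro u
      rw [sum_Iic_fin (fun k => g (k + 1) - g k), Finset.sum_range_sub, h0, add_sub_cancel]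
      exact ⟨(hst u.1 u.2).2.1, hcfg _ u.2⟩

lemma fiber_two {N : ℕ} {S : Fin N → Finset (Fin R × Fin C)} {i i' : Fin R} {j j' : Fin C}
    (hi : i ≠ i') (hj : j ≠ j') {w : Table R C} (hw : ∀ p, 0 ≤ w p)
    (h : configMap S w = configMap S (e (i, j) + e (i', j'))) :
    w = e (i, j) + e (i', j') ∨ w = e (i', j) + e (i, j') := by
  have hrow : ∀ a, ∑ b, w (a, b) = (if a = i then 1 else 0) + (if a = i' then 1 else 0) := by
    intro a
    have := congrFun (congrArg Prod.fst h) a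
    simp only [configMap, Pi.add_apply, Finset.sum_add_distrib, sum_row_e] at this
    exact this
  have hcol : ∀ b, ∑ a, w (a, b) = (if b = j then 1 else 0) + (if b = j' then 1 else 0) := by
    intro a
    have := congrFun (congrArg (fun t => t.2.1) h) a
    simp only [configMap, Pi.add_apply, Finset.sum_add_distrib, sum_col_e] at this
    exact this
  have zr : ∀ a b, a ≠ i → a ≠ i' → w (a, b) = 0 := by
    intro a b h1 h2
    have := hrow a
    rw [if_neg h1, if_neg h2, add_zero, Finset.sum_eq_zero_iff_of_nonneg (fun b _ => hw _)] at this
    exact this b (by simp)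
  have zc : ∀ a b, b ≠ j → b ≠ j' → w (a, b) = 0 := by
    intro a b h1 h2
    have := hcol b
    rw [if_neg h1, if_neg h2, add_zero, Finset.sum_eq_zero_iff_of_nonneg (fun b _ => hw _)] at this
    exact this a (by simp)
  have r1 : ∀ a, ∑ b, w (a, b) = w (a, j) + w (a, j') := fun a =>
    Fintype.sum_eq_add j j' hj (fun b hb => zc a b hb.1 hb.2)
  have c1 : ∀ b, ∑ a, w (a, b) = w (i, b) + w (i', b) := fun b =>
    Fintype.sum_eq_add i i' hi (fun a ha => zr a b ha.1 ha.2)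
  have q1 := hrow i
  have q2 := hrow i'
  have q3 := hcol j
  rw [r1] at q1 q2
  rw [c1] at q3
  simp only [if_true, if_neg hi, if_neg hi.symm, if_neg hj, if_neg hj.symm, add_zero, zero_add]
    at q1 q2 q3
  have p1 := hw (i, j)
  have p2 := hw (i', j)
  have p3 := hw (i, j')
  have p4 := hw (i', j')
  have hcase : w (i, j) = 1 ∨ w (i, j) = 0 := by omega
  rcases hcase with hc | hc
  · left
    funext ⟨a, b⟩
    by_cases ha : a = i
    · subst ha
      by_cases hb : b = j
      · subst hb; simp [e, hc, hi]
      by_cases hb' : b = j'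
      · subst hb'; simp [e, hi, hb]; omega
      · rw [zc _ _ hb hb']; simp [e, hb, hb']
    by_cases ha' : a = i'
    · subst ha'
      by_cases hb : b = j
      · subst hb; simp [e, ha, hj]; omega
      by_cases hb' : b = j'
      · subst hb'; simp [e, ha]; omega
      · rw [zc _ _ hb hb']; simp [e, hb, hb']
    · rw [zr _ _ ha ha']; simp [e, ha, ha']
  · right
    funext ⟨a, b⟩
    by_cases ha : a = i
    · subst ha
      by_cases hb : b = j
      · subst hb; simp [e, hc, hi, hj]
      by_cases hb' : b = j'
      · subst hb'; simp [e, hi]; omega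
      · rw [zc _ _ hb hb']; simp [e, hb, hb']
    by_cases ha' : a = i'
    · subst ha'
      by_cases hb : b = j
      · subst hb; simp [e, ha]; omega
      by_cases hb' : b = j'
      · subst hb'; simp [e, ha, hb]; omega
      · rw [zc _ _ hb hb']; simp [e, hb, hb']
    · rw [zr _ _ ha ha']; simp [e, ha, ha']

lemma markov_contains {N : ℕ} {S : Fin N → Finset (Fin R × Fin C)} (B : Set (Table R C))
    (hB : IsMarkovBasis S B) : {z | IsBasicMove z ∧ IsMove S z} ⊆ B := by
  rintro z ⟨⟨i, i', j, j', hi, hj, hz⟩, hm⟩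
  obtain ⟨-, -, hneg, hpath⟩ := hB
  set x : Table R C := e (i, j) + e (i', j') with hxd
  set y : Table R C := e (i', j) + e (i, j') with hyd
  have hzxy : z = x - y := by rw [hz, hxd, hyd]; abel
  have hcfg : configMap S y = configMap S x := by
    have : configMap S (x - y) = 0 := hzxy ▸ hm
    rw [configMap_sub, sub_eq_zero] at this
    exact this.symm
  have hxy : x ≠ y := by
    intro h
    have := congrFun h (i, j)
    simp [hxd, hyd, e, hi, hj] at this
  obtain ⟨U, -, zs, hzs, hsum, hfib⟩ := hpath (configMap S x)
    x ⟨fun p => add_nonneg (e_nonneg _ p) (e_nonneg _ p), rfl⟩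
    y ⟨fun p => add_nonneg (e_nonneg _ p) (e_nonneg _ p), hcfg⟩ hxy
  by_contra hzB
  have hnB : y - x ∉ B := fun h => hzB (by
    have := hneg _ h
    rwa [neg_sub, ← hzxy] at this)
  let F : ℕ → Table R C := fun k => if h : k < U then zs ⟨k, h⟩ else 0
  have hF : ∀ s : Fin U, zs s = F s.1 := fun s => by simp [F]
  simp only [hF] at hsum hfib hzs
  rw [Fin.sum_univ_eq_sum_range F] at hsum
  simp only [sum_Iic_fin F] at hfib
  have key : ∀ k ≤ U, x + ∑ s ∈ Finset.range k, F s = x := by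
    intro k
    induction k with
    | zero => simp
    | succ k ih =>
      intro hk
      have hk' := ih (by omega)
      have hf := hfib ⟨k, hk⟩
      simp only at hf
      rcases fiber_two hi hj hf.1 hf.2 with h | h
      · exact h
      · exfalso
        apply hnB
        rw [Finset.sum_range_succ, ← add_assoc, hk'] at h
        have h2 : F k = y - x := by rw [hyd, ← h]; abel
        rw [← h2]
        exact hzs ⟨k, hk⟩
  exact hxy ((key U le_rfl).symm.trans hsum.symm)

end

/-- for the change point model the set of basic moves in
`M_{S_1,…,S_N}` is the unique minimal Markov basis for `A_{S_1,…,S_N}`. -/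
theorem changePoint_basicMoves_uniqueMinimalMarkovBasis (R C N : ℕ) (hN : 1 ≤ N)
    (S : ℕ → Finset (Fin R × Fin C))
    (hrect : ∀ n, 1 ≤ n → n ≤ N → IsRectangle (S n))
    (hchain : ∀ n m, 1 ≤ n → n < m → m ≤ N → S n ⊂ S m)
    (htop : S N ⊂ Finset.univ) :
    IsMarkovBasis (fun n : Fin N => S (n.1 + 1))
      {z | IsBasicMove z ∧ IsMove (fun n : Fin N => S (n.1 + 1)) z} ∧
    ∀ B, IsMarkovBasis (fun n : Fin N => S (n.1 + 1)) B →
      {z | IsBasicMove z ∧ IsMove (fun n : Fin N => S (n.1 + 1)) z} ⊆ B := by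
  have hlev : ∃ (α : Fin R → ℕ) (β : Fin C → ℕ), (∀ i, α i ≤ N) ∧ (∀ j, β j ≤ N) ∧
      ∀ (n : Fin N) p, p ∈ S (n.1 + 1) ↔ α p.1 ≤ n.1 ∧ β p.2 ≤ n.1 := by
    have hr : ∀ n : Fin N, IsRectangle (S (n.1 + 1)) := fun n =>
      hrect _ (by omega) (by have := n.2; omega)
    have hmono : ∀ n m : Fin N, n ≤ m → S (n.1 + 1) ⊆ S (m.1 + 1) := by
      intro n m hnm
      have h1 : n.1 ≤ m.1 := hnm
      rcases Nat.eq_or_lt_of_le h1 with h2 | h2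
      · rw [h2]
      · exact (hchain _ _ (by omega) (by omega) (by have := m.2; omega)).1
    choose a₁ a₂ b₁ b₂ ha hb hSe using hr
    have hmem : ∀ (n : Fin N) p, p ∈ S (n.1 + 1) ↔
        (a₁ n ≤ p.1 ∧ p.1 ≤ a₂ n) ∧ (b₁ n ≤ p.2 ∧ p.2 ≤ b₂ n) := by
      intro n p
      rw [hSe n]
      simp [and_assoc]
    have hα : ∀ i : Fin R, ∃ k : ℕ, k ≤ N ∧ ∀ n : Fin N, (a₁ n ≤ i ∧ i ≤ a₂ n) ↔ k ≤ n.1 := by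
      intro i
      refine exists_level _ ?_
      intro n m hnm h
      have h1 := hmono n m hnm ((hmem n (i, b₁ n)).2 ⟨h, le_refl _, (hb n).le⟩)
      exact ((hmem m _).1 h1).1
    have hβ : ∀ j : Fin C, ∃ k : ℕ, k ≤ N ∧ ∀ n : Fin N, (b₁ n ≤ j ∧ j ≤ b₂ n) ↔ k ≤ n.1 := by
      intro j
      refine exists_level _ ?_
      intro n m hnm h
      have h1 := hmono n m hnm ((hmem n (a₁ n, j)).2 ⟨⟨le_refl _, (ha n).le⟩, h⟩)
      exact ((hmem m _).1 h1).2
    choose α hαN hα using hα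
    choose β hβN hβ using hβ
    refine ⟨α, β, hαN, hβN, fun n p => ?_⟩
    rw [hmem, hα, hβ]
  obtain ⟨α, β, hα, hβ, hS⟩ := hlev
  refine ⟨markov_main (α := α) (β := β) ?_ ?_, fun B hB => markov_contains B hB⟩
  · intro n p
    rw [hS, lev, max_le_iff]
  · intro p
    exact max_le (hα _) (hβ _)

end Paper
end

section
/- Let S_1 ⊂ S_2 ⊂ ⋯ ⊂ S_N ⊂ I be rectangles with all inclusions strict. Then the toric ideal ker π is generated by the quadratic binomials {x_{ik} x_{jl} − x_{il} x_{jk} : 1 ≤ i < j ≤ R, 1 ≤ k < l ≤ C, π(x_{ik} x_{jl}) = π(x_{il} x_{jk})}. -/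
open Finset

namespace Paper

/-- The monomial map `π` of the change point model: `π(x_{ij}) = u_i v_j w_n`
for `(i,j) ∈ S_n ∖ S_{n−1}`, where `lev (i,j) = n`. -/
noncomputable def piCP (K : Type) [CommSemiring K] (R C : ℕ)
    (lev : Fin R × Fin C → ℕ) :
    MvPolynomial (Fin R × Fin C) K →ₐ[K] MvPolynomial (Fin R ⊕ (Fin C ⊕ ℕ)) K :=
  MvPolynomial.aeval fun p =>
    MvPolynomial.X (Sum.inl p.1) * MvPolynomial.X (Sum.inr (Sum.inl p.2)) *
      MvPolynomial.X (Sum.inr (Sum.inr (lev p)))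

section Aux

variable {I J : Type} {A : Type} [CommMonoid A]

def Fib (α : I → ℕ) (β : J → ℕ) (x y : Multiset (I × J)) : Prop :=
  x.map Prod.fst = y.map Prod.fst ∧ x.map Prod.snd = y.map Prod.snd ∧
    x.map (fun p => max (α p.1) (β p.2)) = y.map (fun p => max (α p.1) (β p.2))

lemma Fib.symm' {α : I → ℕ} {β : J → ℕ} {x y : Multiset (I × J)} (h : Fib α β x y) :
    Fib α β y x := ⟨h.1.symm, h.2.1.symm, h.2.2.symm⟩

lemma Fib.trans' {α : I → ℕ} {β : J → ℕ} {x y z : Multiset (I × J)} (h : Fib α β x y)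
    (h' : Fib α β y z) : Fib α β x z :=
  ⟨h.1.trans h'.1, h.2.1.trans h'.2.1, h.2.2.trans h'.2.2⟩

lemma Fib.card_eq {α : I → ℕ} {β : J → ℕ} {x y : Multiset (I × J)} (h : Fib α β x y) :
    x.card = y.card := by
  have := congrArg Multiset.card h.1
  simpa using this

lemma Fib.strip {α : I → ℕ} {β : J → ℕ} {x y : Multiset (I × J)} {p : I × J}
    (h : Fib α β (p ::ₘ x) (p ::ₘ y)) : Fib α β x y := by
  obtain ⟨h1, h2, h3⟩ := h
  simp only [Multiset.map_cons, Multiset.cons_inj_right] at h1 h2 h3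
  exact ⟨h1, h2, h3⟩

lemma Fib.row {α : I → ℕ} {β : J → ℕ} {x y : Multiset (I × J)} (h : Fib α β x y)
    {i : I} {k : J} (hx : (i, k) ∈ x) : ∃ l, (i, l) ∈ y := by
  have : i ∈ x.map Prod.fst := Multiset.mem_map.2 ⟨_, hx, rfl⟩
  rw [h.1] at this
  obtain ⟨⟨a, b⟩, hp, rfl⟩ := Multiset.mem_map.1 this
  exact ⟨b, hp⟩

lemma Fib.col {α : I → ℕ} {β : J → ℕ} {x y : Multiset (I × J)} (h : Fib α β x y)
    {i : I} {k : J} (hx : (i, k) ∈ x) : ∃ j, (j, k) ∈ y := by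
  have : k ∈ x.map Prod.snd := Multiset.mem_map.2 ⟨_, hx, rfl⟩
  rw [h.2.1] at this
  obtain ⟨⟨a, b⟩, hp, rfl⟩ := Multiset.mem_map.1 this
  exact ⟨a, hp⟩

lemma Fib.bdd {α : I → ℕ} {β : J → ℕ} {x y : Multiset (I × J)} (h : Fib α β x y) {M : ℕ}
    (hx : ∀ p ∈ x, α p.1 ≤ M ∧ β p.2 ≤ M) : ∀ p ∈ y, α p.1 ≤ M ∧ β p.2 ≤ M := by
  rintro ⟨i, k⟩ hp
  obtain ⟨l, hl⟩ := h.symm'.row hp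
  obtain ⟨j, hj⟩ := h.symm'.col hp
  exact ⟨(hx _ hl).1, (hx _ hj).2⟩

lemma countP_comp {T U : Type} (f : T → U) (P : U → Prop) [DecidablePred P] (x : Multiset T) :
    (x.map f).countP P = x.countP (fun t => P (f t)) := by
  rw [Multiset.countP_map, Multiset.countP_eq_card_filter]

lemma count_id1 (α : I → ℕ) (β : J → ℕ) (n : ℕ) (x : Multiset (I × J)) :
    x.countP (fun p => max (α p.1) (β p.2) = n) + x.countP (fun p => n < α p.1 ∧ β p.2 = n)
      = x.countP (fun p => β p.2 = n) + x.countP (fun p => α p.1 = n ∧ β p.2 < n) := by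
  induction x using Multiset.induction with
  | empty => simp
  | cons p x ih =>
    simp only [Multiset.countP_cons]
    split_ifs <;> omega

lemma count_id2 (α : I → ℕ) (β : J → ℕ) (n : ℕ) (x : Multiset (I × J)) :
    x.countP (fun p => max (α p.1) (β p.2) = n) + x.countP (fun p => α p.1 = n ∧ β p.2 = n)
      + x.countP (fun p => n < α p.1 ∧ β p.2 = n) + x.countP (fun p => α p.1 = n ∧ n < β p.2)
      = x.countP (fun p => α p.1 = n) + x.countP (fun p => β p.2 = n) := by
  induction x using Multiset.induction with
  | empty => simp
  | cons p x ih =>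
    simp only [Multiset.countP_cons]
    split_ifs <;> omega

lemma Fib.counts {α : I → ℕ} {β : J → ℕ} {x y : Multiset (I × J)} (h : Fib α β x y) (n : ℕ) :
    x.countP (fun p => max (α p.1) (β p.2) = n) = y.countP (fun p => max (α p.1) (β p.2) = n) ∧
    x.countP (fun p => α p.1 = n) = y.countP (fun p => α p.1 = n) ∧
    x.countP (fun p => β p.2 = n) = y.countP (fun p => β p.2 = n) := by
  refine ⟨?_, ?_, ?_⟩
  · have := congrArg (Multiset.countP (fun m => m = n)) h.2.2
    simpa only [countP_comp] using this
  · have := congrArg (Multiset.countP (fun i => α i = n)) h.1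
    simpa only [countP_comp] using this
  · have := congrArg (Multiset.countP (fun i => β i = n)) h.2.1
    simpa only [countP_comp] using this

lemma swap_step {α : I → ℕ} {β : J → ℕ} {f : I × J → A}
    (hswap : ∀ i j k l,
      ((max (α i) (β k) = max (α i) (β l) ∧ max (α j) (β l) = max (α j) (β k)) ∨
       (max (α i) (β k) = max (α j) (β k) ∧ max (α j) (β l) = max (α i) (β l))) →
      f (i, k) * f (j, l) = f (i, l) * f (j, k))
    {x : Multiset (I × J)} {i j : I} {k l : J} (h1 : (i, k) ∈ x) (h2 : (j, l) ∈ x) (hkl : k ≠ l)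
    (e1 : max (α i) (β k) = max (α i) (β l)) (e2 : max (α j) (β l) = max (α j) (β k)) :
    ∃ x', Fib α β x x' ∧ (x.map f).prod = (x'.map f).prod ∧ (i, l) ∈ x' := by
  obtain ⟨t, rfl⟩ := Multiset.exists_cons_of_mem h1
  have h3 : (j, l) ∈ t := by
    rcases Multiset.mem_cons.1 h2 with h | h
    · exact absurd (Prod.mk.inj h).2.symm hkl
    · exact h
  obtain ⟨s, rfl⟩ := Multiset.exists_cons_of_mem h3
  refine ⟨(i, l) ::ₘ (j, k) ::ₘ s, ⟨?_, ?_, ?_⟩, ?_, ?_⟩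
  · simp
  · simp only [Multiset.map_cons]; exact Multiset.cons_swap _ _ _
  · simp only [Multiset.map_cons, e1, e2]
  · simp only [Multiset.map_cons, Multiset.prod_cons, ← mul_assoc]
    rw [hswap i j k l (Or.inl ⟨e1, e2⟩)]
  · simp

lemma inner_step {α : I → ℕ} {β : J → ℕ} {f : I × J → A}
    (hswap : ∀ i j k l,
      ((max (α i) (β k) = max (α i) (β l) ∧ max (α j) (β l) = max (α j) (β k)) ∨
       (max (α i) (β k) = max (α j) (β k) ∧ max (α j) (β l) = max (α i) (β l))) →
      f (i, k) * f (j, l) = f (i, l) * f (j, k))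
    (i0 : I) (d : ℕ)
    (hstrip : ∀ x y : Multiset (I × J), x.card < d → Fib α β x y →
      (x.map f).prod = (y.map f).prod) :
    ∀ (s : ℕ) (x y : Multiset (I × J)), x.card = d → Fib α β x y →
      (∀ p ∈ x, α p.1 ≤ α i0 ∧ β p.2 ≤ α i0) → ∀ k l, (i0, k) ∈ x → (i0, l) ∈ y →
      β k + β l ≤ s → (x.map f).prod = (y.map f).prod := by
  have hcommon : ∀ (x y : Multiset (I × J)) (p : I × J), x.card = d → Fib α β x y →
      p ∈ x → p ∈ y → (x.map f).prod = (y.map f).prod := by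
    intro x y p hd hF hx hy
    obtain ⟨x, rfl⟩ := Multiset.exists_cons_of_mem hx
    obtain ⟨y, rfl⟩ := Multiset.exists_cons_of_mem hy
    simp only [Multiset.map_cons, Multiset.prod_cons]
    rw [hstrip x y (by simp at hd; omega) hF.strip]
  have heq : ∀ (x y : Multiset (I × J)), x.card = d → Fib α β x y →
      ∀ k l, (i0, k) ∈ x → (i0, l) ∈ y → β k = β l → (x.map f).prod = (y.map f).prod := by
    intro x y hd hF k l hk hl hkl
    by_cases h : k = l
    · subst h; exact hcommon x y _ hd hF hk hl
    · obtain ⟨j, hj⟩ := hF.symm'.col hl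
      obtain ⟨x', hF', hp, hm⟩ := swap_step hswap hk hj h (by rw [hkl]) (by rw [hkl])
      rw [hp]
      exact hcommon x' y _ (by rw [← hF'.card_eq, hd]) (hF'.symm'.trans' hF) hm hl
  intro s
  induction s using Nat.strong_induction_on with
  | _ s ih =>
  have hlt : ∀ (x y : Multiset (I × J)), x.card = d → Fib α β x y →
      (∀ p ∈ x, α p.1 ≤ α i0 ∧ β p.2 ≤ α i0) → ∀ k l, (i0, k) ∈ x → (i0, l) ∈ y →
      β k + β l ≤ s → β k < β l → (x.map f).prod = (y.map f).prod := by
    intro x y hd hF hb k l hk hl hs hkl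
    have hby := hF.bdd hb
    by_cases hex : ∃ p ∈ x, β l ≤ α p.1 ∧ β p.2 = β l
    · obtain ⟨⟨j, l'⟩, hp, hα, hβ⟩ := hex
      simp only at hα hβ
      have b1 := (hb _ hk).2
      have b2 := (hb _ hp).2
      simp only at b1 b2
      have hne : k ≠ l' := by rintro rfl; omega
      obtain ⟨x', hF', hpr, hm⟩ := swap_step hswap hk hp hne (by omega) (by omega)
      rw [hpr]
      exact heq x' y (by rw [← hF'.card_eq, hd]) (hF'.symm'.trans' hF) l' l hm hl hβ
    · push Not at hex
      obtain ⟨c1, c2, c3⟩ := hF.counts (β l)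
      have bl := (hby _ hl).2
      simp only at bl
      have hxGE : x.countP (fun p => β l < α p.1 ∧ β p.2 = β l) = 0 := by
        rw [Multiset.countP_eq_zero]
        rintro p hp ⟨h1, h2⟩
        exact hex p hp h1.le h2
      have hxEE : x.countP (fun p => α p.1 = β l ∧ β p.2 = β l) = 0 := by
        rw [Multiset.countP_eq_zero]
        rintro p hp ⟨h1, h2⟩
        exact hex p hp h1.ge h2
      rcases bl.lt_or_eq with hM | hM
      · have hyGE : 0 < y.countP (fun p => β l < α p.1 ∧ β p.2 = β l) :=
          Multiset.countP_pos.2 ⟨_, hl, hM, rfl⟩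
        have i1 := count_id1 α β (β l) x
        have i2 := count_id1 α β (β l) y
        have hpos : 0 < y.countP (fun p => α p.1 = β l ∧ β p.2 < β l) := by omega
        obtain ⟨⟨a, b⟩, hab, ha, hb'⟩ := Multiset.countP_pos.1 hpos
        simp only at ha hb'
        have hne : l ≠ b := by rintro rfl; omega
        obtain ⟨y', hF', hpr, hm⟩ := swap_step hswap hl hab hne (by omega) (by omega)
        rw [hpr]
        exact ih (β k + β b) (by omega) x y' hd (hF.trans' hF') hb k b hk hm le_rfl
      · exfalso
        have hyEE : 0 < y.countP (fun p => α p.1 = β l ∧ β p.2 = β l) :=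
          Multiset.countP_pos.2 ⟨_, hl, hM.symm, rfl⟩
        have hyGE : y.countP (fun p => β l < α p.1 ∧ β p.2 = β l) = 0 := by
          rw [Multiset.countP_eq_zero]
          rintro p hp ⟨h1, h2⟩
          have := (hby p hp).1
          omega
        have hyEG : y.countP (fun p => α p.1 = β l ∧ β l < β p.2) = 0 := by
          rw [Multiset.countP_eq_zero]
          rintro p hp ⟨h1, h2⟩
          have := (hby p hp).2
          omega
        have hxEG : x.countP (fun p => α p.1 = β l ∧ β l < β p.2) = 0 := by
          rw [Multiset.countP_eq_zero]
          rintro p hp ⟨h1, h2⟩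
          have := (hb p hp).2
          omega
        have i1 := count_id2 α β (β l) x
        have i2 := count_id2 α β (β l) y
        omega
  intro x y hd hF hb k l hk hl hs
  rcases lt_trichotomy (β k) (β l) with h | h | h
  · exact hlt x y hd hF hb k l hk hl hs h
  · exact heq x y hd hF k l hk hl h
  · exact (hlt y x (by rw [← hF.card_eq, hd]) hF.symm' (hF.bdd hb) l k hl hk (by omega) h).symm

lemma exists_max_mem {T : Type} (g : T → ℕ) (x : Multiset T) (hx : x ≠ 0) :
    ∃ p ∈ x, ∀ q ∈ x, g q ≤ g p := by
  induction x using Multiset.induction with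
  | empty => exact absurd rfl hx
  | cons a x ih =>
    by_cases h : x = 0
    · subst h; exact ⟨a, by simp, by simp⟩
    · obtain ⟨p, hp, hq⟩ := ih h
      rcases le_total (g p) (g a) with h' | h'
      · refine ⟨a, by simp, fun q hq' => ?_⟩
        rcases Multiset.mem_cons.1 hq' with rfl | h2
        · exact le_rfl
        · exact (hq q h2).trans h'
      · refine ⟨p, by simp [hp], fun q hq' => ?_⟩
        rcases Multiset.mem_cons.1 hq' with rfl | h2
        · exact h'
        · exact hq q h2

lemma Fib.swap {α : I → ℕ} {β : J → ℕ} {x y : Multiset (I × J)} (h : Fib α β x y) :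
    Fib β α (x.map Prod.swap) (y.map Prod.swap) := by
  obtain ⟨h1, h2, h3⟩ := h
  refine ⟨?_, ?_, ?_⟩
  · simpa [Multiset.map_map, Function.comp_def] using h2
  · simpa [Multiset.map_map, Function.comp_def] using h1
  · simpa [Multiset.map_map, Function.comp_def, max_comm] using h3

theorem fib_conn {α : I → ℕ} {β : J → ℕ} {f : I × J → A}
    (hswap : ∀ i j k l,
      ((max (α i) (β k) = max (α i) (β l) ∧ max (α j) (β l) = max (α j) (β k)) ∨
       (max (α i) (β k) = max (α j) (β k) ∧ max (α j) (β l) = max (α i) (β l))) →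
      f (i, k) * f (j, l) = f (i, l) * f (j, k)) :
    ∀ (d : ℕ) (x y : Multiset (I × J)), x.card = d → Fib α β x y →
      (x.map f).prod = (y.map f).prod := by
  intro d
  induction d using Nat.strong_induction_on with
  | _ d ih =>
  intro x y hd hF
  by_cases hx : x = 0
  · subst hx
    have : y = 0 := by
      have := hF.card_eq
      simpa using this.symm
    rw [this]
  obtain ⟨⟨i, k⟩, hp, hmax⟩ := exists_max_mem (fun p : I × J => max (α p.1) (β p.2)) x hx
  simp only at hmax
  have hstrip : ∀ x y : Multiset (I × J), x.card < d → Fib α β x y →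
      (x.map f).prod = (y.map f).prod := fun x y h hF => ih _ h x y rfl hF
  rcases le_total (β k) (α i) with h | h
  · obtain ⟨l, hl⟩ := hF.row hp
    refine inner_step hswap i d hstrip _ x y hd hF (fun q hq => ?_) k l hp hl le_rfl
    have := hmax q hq
    omega
  · obtain ⟨j, hj⟩ := hF.col hp
    have key := inner_step (α := β) (β := α) (f := fun p => f p.swap) (by
        intro a b c e he
        simp only [Prod.swap_prod_mk]
        rw [hswap c e a b (by
          simp only [max_comm (β _) (α _)] at he
          tauto), mul_comm]) k d (by
        intro u v hu hF'
        have := hstrip (u.map Prod.swap) (v.map Prod.swap) (by simpa using hu) hF'.swap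
        simpa [Multiset.map_map, Function.comp_def] using this) _
        (x.map Prod.swap) (y.map Prod.swap) (by simpa using hd) hF.swap (by
          intro q hq
          obtain ⟨q', hq', rfl⟩ := Multiset.mem_map.1 hq
          have := hmax q' hq'
          simp only [Prod.fst_swap, Prod.snd_swap]
          omega) i j (Multiset.mem_map.2 ⟨_, hp, rfl⟩) (Multiset.mem_map.2 ⟨_, hj, rfl⟩) le_rfl
    simpa [Multiset.map_map, Function.comp_def] using key

lemma lev_eq_max {R C N : ℕ} 
    (S : ℕ → Finset (Fin R × Fin C)) (hS0 : S 0 = ∅) (hStop : S (N + 1) = Finset.univ)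
    (hrect : ∀ n, 1 ≤ n → n ≤ N → IsRectangle (S n))
    (hchain : ∀ n m, 1 ≤ n → n < m → m ≤ N → S n ⊂ S m)
    (lev : Fin R × Fin C → ℕ)
    (hlev : ∀ p n, 1 ≤ n → n ≤ N + 1 → (lev p = n ↔ p ∈ S n ∧ p ∉ S (n - 1))) :
    ∃ (α : Fin R → ℕ) (β : Fin C → ℕ), ∀ p, lev p = max (α p.1) (β p.2) := by
  have hmono : ∀ n m, 1 ≤ n → n ≤ m → m ≤ N + 1 → S n ⊆ S m := by
    intro n m h1 h2 h3
    rcases h2.lt_or_eq with h | rfl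
    · rcases h3.lt_or_eq with h' | rfl
      · exact (hchain n m h1 h (by omega)).1
      · rw [hStop]; exact Finset.subset_univ _
    · exact subset_rfl
  have hprod : ∀ n, 1 ≤ n → n ≤ N + 1 → ∀ i k i' k', (i, k') ∈ S n → (i', k) ∈ S n →
      (i, k) ∈ S n := by
    intro n h1 h2 i k i' k' h h'
    rcases h2.lt_or_eq with h3 | rfl
    · obtain ⟨a1, a2, b1, b2, -, -, hS⟩ := hrect n h1 (by omega)
      rw [hS] at h h' ⊢
      simp only [Finset.mem_filter, Finset.mem_univ, true_and] at h h' ⊢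
      tauto
    · rw [hStop]; exact Finset.mem_univ _
  refine ⟨fun i => sInf {n | 1 ≤ n ∧ ∃ k, (i, k) ∈ S n},
    fun k => sInf {n | 1 ≤ n ∧ ∃ i, (i, k) ∈ S n}, ?_⟩
  rintro ⟨i, k⟩
  have hex : ∃ n, (i, k) ∈ S n := ⟨N + 1, by rw [hStop]; exact Finset.mem_univ _⟩
  classical
  obtain ⟨n, hn1, hn2, hn⟩ : ∃ n, 1 ≤ n ∧ n ≤ N + 1 ∧ lev (i, k) = n := by
    have hs := Nat.find_spec hex
    have h1 : 1 ≤ Nat.find hex := by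
      by_contra h
      have h0 : Nat.find hex = 0 := by omega
      rw [h0, hS0] at hs
      simp at hs
    have h2 : Nat.find hex ≤ N + 1 := Nat.find_min' hex (by rw [hStop]; exact Finset.mem_univ _)
    refine ⟨Nat.find hex, h1, h2, (hlev _ _ h1 h2).2 ⟨hs, ?_⟩⟩
    exact Nat.find_min hex (by omega)
  rw [hn]
  obtain ⟨hin, hout⟩ := (hlev _ _ hn1 hn2).1 hn
  have ma : n ∈ {n | 1 ≤ n ∧ ∃ k, (i, k) ∈ S n} := ⟨hn1, k, hin⟩
  have mb : n ∈ {n | 1 ≤ n ∧ ∃ i, (i, k) ∈ S n} := ⟨hn1, i, hin⟩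
  have la := Nat.sInf_le ma
  have lb := Nat.sInf_le mb
  obtain ⟨pa, ka, ha⟩ := Nat.sInf_mem ⟨n, ma⟩
  obtain ⟨pb, kb, hb⟩ := Nat.sInf_mem ⟨n, mb⟩
  simp only
  generalize sInf {n | 1 ≤ n ∧ ∃ k, (i, k) ∈ S n} = a at *
  generalize sInf {n | 1 ≤ n ∧ ∃ i, (i, k) ∈ S n} = b at *
  by_contra hne
  have h1 : a ≤ n - 1 := by omega
  have h2 : b ≤ n - 1 := by omega
  exact hout (hprod (n - 1) (by omega) (by omega) i k kb ka
    (hmono _ _ pa h1 (by omega) ha) (hmono _ _ pb h2 (by omega) hb))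

open MvPolynomial in
lemma prodX_eq {σ K : Type} [DecidableEq σ] [CommSemiring K] (T : Multiset σ) :
    (T.map (fun s => (X s : MvPolynomial σ K))).prod = monomial (Multiset.toFinsupp T) 1 := by
  induction T using Multiset.induction with
  | empty => simp
  | cons a T ih =>
    rw [Multiset.map_cons, Multiset.prod_cons, ih, X, monomial_mul,
      ← Multiset.singleton_add, map_add, Multiset.toFinsupp_singleton, one_mul]

/-- the image multiset -/
def imgM {R C : ℕ} (lev : Fin R × Fin C → ℕ) (x : Multiset (Fin R × Fin C)) :
    Multiset (Fin R ⊕ (Fin C ⊕ ℕ)) :=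
  x.map (fun p => Sum.inl p.1) + x.map (fun p => Sum.inr (Sum.inl p.2)) +
    x.map (fun p => Sum.inr (Sum.inr (lev p)))

lemma imgM_inj {R C : ℕ} {lev : Fin R × Fin C → ℕ} {x y : Multiset (Fin R × Fin C)}
    (h : imgM lev x = imgM lev y) : x.map Prod.fst = y.map Prod.fst ∧
    x.map Prod.snd = y.map Prod.snd ∧ x.map lev = y.map lev := by
  have key : ∀ z : Multiset (Fin R × Fin C),
      (imgM lev z).filterMap (Sum.elim some (fun _ => none)) = z.map Prod.fst ∧
      (imgM lev z).filterMap (Sum.elim (fun _ => none) (Sum.elim some (fun _ => none)))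
        = z.map Prod.snd ∧
      (imgM lev z).filterMap (Sum.elim (fun _ => none) (Sum.elim (fun _ => none) some))
        = z.map lev := by
    intro z
    induction z using Multiset.induction with
    | empty => simp [imgM]
    | cons p z ih =>
      have hc : imgM lev (p ::ₘ z) = Sum.inl p.1 ::ₘ Sum.inr (Sum.inl p.2) ::ₘ
          Sum.inr (Sum.inr (lev p)) ::ₘ imgM lev z := by
        simp only [imgM, ← Multiset.singleton_add, Multiset.map_add, Multiset.map_singleton]
        abel
      rw [hc]
      obtain ⟨h1, h2, h3⟩ := ih
      refine ⟨?_, ?_, ?_⟩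
      · simp [Multiset.filterMap_cons, h1]
      · simp [Multiset.filterMap_cons, h2]
      · simp [Multiset.filterMap_cons, h3]
  refine ⟨?_, ?_, ?_⟩
  · rw [← (key x).1, ← (key y).1, h]
  · rw [← (key x).2.1, ← (key y).2.1, h]
  · rw [← (key x).2.2, ← (key y).2.2, h]

open MvPolynomial in
lemma piCP_prod {K : Type} [CommSemiring K] {R C : ℕ} (lev : Fin R × Fin C → ℕ)
    (x : Multiset (Fin R × Fin C)) :
    piCP K R C lev (x.map (fun s => X s)).prod = monomial (Multiset.toFinsupp (imgM lev x)) 1 := by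
  rw [← prodX_eq, map_multiset_prod, imgM]
  simp only [Multiset.map_add, Multiset.prod_add, Multiset.map_map, Function.comp_def,
    ← Multiset.prod_map_mul, piCP, aeval_X]

end Aux

/-- the toric ideal `ker π` of the change point model is generated by
the quadratic binomials `x_{ik}x_{jl} − x_{il}x_{jk}` with `π(x_{ik}x_{jl}) = π(x_{il}x_{jk})`. -/
theorem changePoint_toricIdeal_quadratic_generators (R C N : ℕ) (hN : 1 ≤ N)
    (K : Type) [Field K]
    (S : ℕ → Finset (Fin R × Fin C)) (hS0 : S 0 = ∅) (hStop : S (N + 1) = Finset.univ)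
    (hrect : ∀ n, 1 ≤ n → n ≤ N → IsRectangle (S n))
    (hchain : ∀ n m, 1 ≤ n → n < m → m ≤ N → S n ⊂ S m)
    (htop : S N ⊂ Finset.univ)
    (lev : Fin R × Fin C → ℕ)
    (hlev : ∀ p n, 1 ≤ n → n ≤ N + 1 → (lev p = n ↔ p ∈ S n ∧ p ∉ S (n - 1))) :
    RingHom.ker (piCP K R C lev).toRingHom =
      Ideal.span {f : MvPolynomial (Fin R × Fin C) K |
        ∃ (i j : Fin R) (k l : Fin C), i < j ∧ k < l ∧
          piCP K R C lev (MvPolynomial.X (i, k) * MvPolynomial.X (j, l)) =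
            piCP K R C lev (MvPolynomial.X (i, l) * MvPolynomial.X (j, k)) ∧
          f = MvPolynomial.X (i, k) * MvPolynomial.X (j, l) -
              MvPolynomial.X (i, l) * MvPolynomial.X (j, k)} := by
  obtain ⟨α, β, hmax⟩ := lev_eq_max S hS0 hStop hrect hchain lev hlev
  set G := {f : MvPolynomial (Fin R × Fin C) K |
        ∃ (i j : Fin R) (k l : Fin C), i < j ∧ k < l ∧
          piCP K R C lev (MvPolynomial.X (i, k) * MvPolynomial.X (j, l)) =
            piCP K R C lev (MvPolynomial.X (i, l) * MvPolynomial.X (j, k)) ∧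
          f = MvPolynomial.X (i, k) * MvPolynomial.X (j, l) -
              MvPolynomial.X (i, l) * MvPolynomial.X (j, k)} with hG
  apply le_antisymm
  swap
  · rw [Ideal.span_le]
    rintro f ⟨i, j, k, l, -, -, h, rfl⟩
    change (piCP K R C lev) _ = 0
    rw [map_sub, h, sub_self]
  have hgen : ∀ (i j : Fin R) (k l : Fin C), i < j → k < l →
      piCP K R C lev (MvPolynomial.X (i, k) * MvPolynomial.X (j, l)) =
            piCP K R C lev (MvPolynomial.X (i, l) * MvPolynomial.X (j, k)) →
      Ideal.Quotient.mk (Ideal.span G) (MvPolynomial.X (i, k)) *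
        Ideal.Quotient.mk (Ideal.span G) (MvPolynomial.X (j, l)) =
      Ideal.Quotient.mk (Ideal.span G) (MvPolynomial.X (i, l)) *
        Ideal.Quotient.mk (Ideal.span G) (MvPolynomial.X (j, k)) := by
    intro i j k l hij hkl h
    rw [← map_mul, ← map_mul, Ideal.Quotient.eq]
    exact Ideal.subset_span ⟨i, j, k, l, hij, hkl, h, rfl⟩
  have hswap : ∀ i j k l,
      ((max (α i) (β k) = max (α i) (β l) ∧ max (α j) (β l) = max (α j) (β k)) ∨
       (max (α i) (β k) = max (α j) (β k) ∧ max (α j) (β l) = max (α i) (β l))) →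
      Ideal.Quotient.mk (Ideal.span G) (MvPolynomial.X (i, k)) *
        Ideal.Quotient.mk (Ideal.span G) (MvPolynomial.X (j, l)) =
      Ideal.Quotient.mk (Ideal.span G) (MvPolynomial.X (i, l)) *
        Ideal.Quotient.mk (Ideal.span G) (MvPolynomial.X (j, k)) := by
    intro i j k l h
    have hpi : piCP K R C lev (MvPolynomial.X (i, k) * MvPolynomial.X (j, l)) =
            piCP K R C lev (MvPolynomial.X (i, l) * MvPolynomial.X (j, k)) := by
      simp only [piCP, map_mul, MvPolynomial.aeval_X, hmax]
      rcases h with ⟨h1, h2⟩ | ⟨h1, h2⟩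
      · rw [h1, h2]; ring
      · rw [h1, h2]; ring
    rcases lt_trichotomy i j with hij | rfl | hij
    · rcases lt_trichotomy k l with hkl | rfl | hkl
      · exact hgen i j k l hij hkl hpi
      · rfl
      · exact (hgen i j l k hij hkl hpi.symm).symm
    · exact mul_comm _ _
    · rcases lt_trichotomy k l with hkl | rfl | hkl
      · have := hgen j i k l hij hkl (by rw [mul_comm, ← hpi, mul_comm])
        rw [mul_comm, ← this, mul_comm]
      · rfl
      · have := hgen j i l k hij hkl (by rw [mul_comm, hpi, mul_comm])
        rw [mul_comm, this, mul_comm]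
  have hconn : ∀ x y : Multiset (Fin R × Fin C), imgM lev x = imgM lev y →
      Ideal.Quotient.mk (Ideal.span G) (x.map (fun s => MvPolynomial.X s)).prod =
      Ideal.Quotient.mk (Ideal.span G) (y.map (fun s => MvPolynomial.X s)).prod := by
    intro x y h
    obtain ⟨h1, h2, h3⟩ := imgM_inj h
    have hl : lev = fun p => max (α p.1) (β p.2) := funext hmax
    rw [hl] at h3
    have := fib_conn (f := fun p => Ideal.Quotient.mk (Ideal.span G) (MvPolynomial.X p)) hswap
      _ x y rfl ⟨h1, h2, h3⟩
    simpa [map_multiset_prod, Multiset.map_map, Function.comp_def] using this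
  classical
  let sec : (Fin R ⊕ (Fin C ⊕ ℕ) →₀ ℕ) → MvPolynomial (Fin R × Fin C) K ⧸ Ideal.span G :=
    fun t => if h : ∃ x : Multiset (Fin R × Fin C), Multiset.toFinsupp (imgM lev x) = t then
      Ideal.Quotient.mk (Ideal.span G) (h.choose.map (fun s => MvPolynomial.X s)).prod else 0
  let σ : MvPolynomial (Fin R ⊕ (Fin C ⊕ ℕ)) K →ₗ[K] MvPolynomial (Fin R × Fin C) K ⧸ Ideal.span G :=
    (MvPolynomial.basisMonomials _ K).constr K sec
  have hσ : σ ∘ₗ (piCP K R C lev).toLinearMap = (Ideal.Quotient.mkₐ K (Ideal.span G)).toLinearMap := by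
    apply (MvPolynomial.basisMonomials (Fin R × Fin C) K).ext
    intro m
    have hm : MvPolynomial.basisMonomials (Fin R × Fin C) K m =
        ((Finsupp.toMultiset m).map (fun s => MvPolynomial.X s)).prod := by
      rw [prodX_eq, MvPolynomial.coe_basisMonomials, Finsupp.toMultiset_toFinsupp]
    rw [hm]
    generalize Finsupp.toMultiset m = x
    simp only [LinearMap.comp_apply, AlgHom.toLinearMap_apply, piCP_prod]
    have h1 : σ (MvPolynomial.monomial (Multiset.toFinsupp (imgM lev x)) 1) =
        sec (Multiset.toFinsupp (imgM lev x)) := by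
      have := (MvPolynomial.basisMonomials (Fin R ⊕ (Fin C ⊕ ℕ)) K).constr_basis K sec
        (Multiset.toFinsupp (imgM lev x))
      rwa [MvPolynomial.coe_basisMonomials] at this
    have hex : ∃ x' : Multiset (Fin R × Fin C),
      Multiset.toFinsupp (imgM lev x') = Multiset.toFinsupp (imgM lev x) := ⟨x, rfl⟩
    rw [h1]
    simp only [sec]
    rw [dif_pos hex]
    exact hconn _ _ (Multiset.toFinsupp.injective hex.choose_spec)
  intro f hf
  have hf' : piCP K R C lev f = 0 := hf
  have := LinearMap.congr_fun hσ f
  simp only [LinearMap.comp_apply, AlgHom.toLinearMap_apply, hf', map_zero] at this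
  exact Ideal.Quotient.eq_zero_iff_mem.1 this.symm

end Paper
end

section
/- Assume S_n = {(i,j) : 1 ≤ i ≤ r_n, 1 ≤ j ≤ c_n} for n = 1,…,N, where 1 < r_1 ≤ ⋯ ≤ r_N ≤ R and 1 < c_1 ≤ ⋯ ≤ c_N ≤ C, and, setting r_{N+1} = R and c_{N+1} = C, for each n = 1,…,N at least one of r_n < r_{n+1} or c_n < c_{n+1} holds. Then for all 1 ≤ i < j ≤ R and 1 ≤ k < l ≤ C: π(x_{ik} x_{jl}) ≠ π(x_{il} x_{jk}) if and only if there exists n with 1 ≤ n ≤ N such that (i,k) ∈ S_n ∖ S_{n−1} and (i,l), (j,k), (j,l) ∉ S_n. -/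
open Finset

namespace Paper

theorem exists_level_s6 (R N : ℕ) (rr : ℕ → ℕ)
    (hm : ∀ n, 1 ≤ n → n < N → rr n ≤ rr (n + 1))
    (hR : rr N ≤ R) (htop : rr (N + 1) = R) (i : ℕ) (hi : i < R) :
    ∃ a : ℕ, 1 ≤ a ∧ a ≤ N + 1 ∧ ∀ n, 1 ≤ n → n ≤ N + 1 → (i + 1 ≤ rr n ↔ a ≤ n) := by
  have hex : ∃ n, 1 ≤ n ∧ i + 1 ≤ rr n := ⟨N + 1, by omega, by omega⟩
  have hs : ∀ n, 1 ≤ n → n ≤ N → rr n ≤ rr (n + 1) := by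
    intro n h1 h2
    rcases Nat.lt_or_ge n N with h | h
    · exact hm n h1 h
    · have : n = N := by omega
      subst this; omega
  have hmono : ∀ m n, 1 ≤ m → m ≤ n → n ≤ N + 1 → rr m ≤ rr n := by
    intro m n h1 h2
    induction n, h2 using Nat.le_induction with
    | base => intro _; exact le_rfl
    | succ n h ih => intro h3; exact (ih (by omega)).trans (hs n (by omega) (by omega))
  classical
  have hsp := Nat.find_spec hex
  refine ⟨Nat.find hex, hsp.1, Nat.find_min' hex ⟨by omega, by omega⟩, ?_⟩
  intro n h1 h2
  constructor
  · intro h; exact Nat.find_min' hex ⟨h1, h⟩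
  · intro h; exact hsp.2.trans (hmono _ _ hsp.1 h h2)

/-- for `S_n = {(i,j) : 1 ≤ i ≤ r_n, 1 ≤ j ≤ c_n}`,
`π(x_{ik}x_{jl}) ≠ π(x_{il}x_{jk})` iff there is an `n` with `1 ≤ n ≤ N`,
`(i,k) ∈ S_n ∖ S_{n−1}` and `(i,l),(j,k),(j,l) ∉ S_n`. -/
theorem changePoint_pi_ne_iff (R C N : ℕ) (hN : 1 ≤ N)
    (K : Type) [Field K] (rr cc : ℕ → ℕ)
    (hr1 : 1 < rr 1) (hc1 : 1 < cc 1)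
    (hrmono : ∀ n, 1 ≤ n → n < N → rr n ≤ rr (n + 1))
    (hcmono : ∀ n, 1 ≤ n → n < N → cc n ≤ cc (n + 1))
    (hrR : rr N ≤ R) (hcC : cc N ≤ C)
    (hrtop : rr (N + 1) = R) (hctop : cc (N + 1) = C)
    (hstrict : ∀ n, 1 ≤ n → n ≤ N → rr n < rr (n + 1) ∨ cc n < cc (n + 1))
    (S : ℕ → Finset (Fin R × Fin C)) (hS0 : S 0 = ∅)
    (hSdef : ∀ n, 1 ≤ n → n ≤ N + 1 →
      S n = Finset.univ.filter fun p => p.1.1 + 1 ≤ rr n ∧ p.2.1 + 1 ≤ cc n)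
    (lev : Fin R × Fin C → ℕ)
    (hlev : ∀ p n, 1 ≤ n → n ≤ N + 1 → (lev p = n ↔ p ∈ S n ∧ p ∉ S (n - 1))) :
    ∀ (i j : Fin R) (k l : Fin C), i < j → k < l →
      (piCP K R C lev (MvPolynomial.X (i, k) * MvPolynomial.X (j, l)) ≠
          piCP K R C lev (MvPolynomial.X (i, l) * MvPolynomial.X (j, k)) ↔
        ∃ n, 1 ≤ n ∧ n ≤ N ∧ ((i, k) ∈ S n ∧ (i, k) ∉ S (n - 1)) ∧
          (i, l) ∉ S n ∧ (j, k) ∉ S n ∧ (j, l) ∉ S n) := by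
  intro i j k l hij hkl
  obtain ⟨a, ha1, haN, ha⟩ := exists_level_s6 R N rr hrmono hrR hrtop i.1 i.2
  obtain ⟨a', ha1', haN', ha'⟩ := exists_level_s6 R N rr hrmono hrR hrtop j.1 j.2
  obtain ⟨b, hb1, hbN, hb⟩ := exists_level_s6 C N cc hcmono hcC hctop k.1 k.2
  obtain ⟨b', hb1', hbN', hb'⟩ := exists_level_s6 C N cc hcmono hcC hctop l.1 l.2
  have hij' : i.1 < j.1 := hij
  have hkl' : k.1 < l.1 := hkl
  have haa : a ≤ a' := (ha a' ha1' haN').1 (by have := (ha' a' ha1' haN').2 le_rfl; omega)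
  have hbb : b ≤ b' := (hb b' hb1' hbN').1 (by have := (hb' b' hb1' hbN').2 le_rfl; omega)
  have key : ∀ (x : Fin R) (y : Fin C) (s t : ℕ), 1 ≤ s → s ≤ N + 1 → 1 ≤ t → t ≤ N + 1 →
      (∀ n, 1 ≤ n → n ≤ N + 1 → (x.1 + 1 ≤ rr n ↔ s ≤ n)) →
      (∀ n, 1 ≤ n → n ≤ N + 1 → (y.1 + 1 ≤ cc n ↔ t ≤ n)) →
      (∀ n, n ≤ N + 1 → ((x, y) ∈ S n ↔ max s t ≤ n)) ∧ lev (x, y) = max s t := by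
    intro x y s t hs1 hs2 ht1 ht2 hs ht
    have h1 : ∀ n, n ≤ N + 1 → ((x, y) ∈ S n ↔ max s t ≤ n) := by
      intro n hn
      rcases Nat.eq_zero_or_pos n with h0 | h0
      · subst h0
        rw [hS0]; simp; omega
      · rw [hSdef n h0 hn]
        simp only [Finset.mem_filter, Finset.mem_univ, true_and]
        rw [hs n h0 hn, ht n h0 hn, max_le_iff]
    refine ⟨h1, ?_⟩
    rw [hlev (x, y) (max s t) (by omega) (by omega), h1 _ (by omega), h1 _ (by omega)]
    omega
  obtain ⟨mik, lik⟩ := key i k a b ha1 haN hb1 hbN ha hb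
  obtain ⟨mil, lil⟩ := key i l a b' ha1 haN hb1' hbN' ha hb'
  obtain ⟨mjk, ljk⟩ := key j k a' b ha1' haN' hb1 hbN ha' hb
  obtain ⟨mjl, ljl⟩ := key j l a' b' ha1' haN' hb1' hbN' ha' hb'
  constructor
  · intro hne
    by_contra hcon
    apply hne
    have hc : ¬ (max a b < a' ∧ max a b < b') := by
      rintro ⟨h1, h2⟩
      apply hcon
      refine ⟨max a b, by omega, by omega, ⟨?_, ?_⟩, ?_, ?_, ?_⟩
      · rw [mik _ (by omega)]
      · rw [mik _ (by omega)]; omega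
      · rw [mil _ (by omega)]; omega
      · rw [mjk _ (by omega)]; omega
      · rw [mjl _ (by omega)]; omega
    have hsw : (max a b = max a b' ∧ max a' b' = max a' b) ∨
        (max a b = max a' b ∧ max a' b' = max a b') := by omega
    simp only [piCP, map_mul, MvPolynomial.aeval_X, lik, lil, ljk, ljl]
    rcases hsw with ⟨h1, h2⟩ | ⟨h1, h2⟩
    · rw [h1, h2]; ring
    · rw [h1, h2]; ring
  · rintro ⟨n, hn1, hnN, ⟨h1, h2⟩, h3, h4, h5⟩ heq
    rw [mik _ (by omega)] at h1 h2
    rw [mil _ (by omega)] at h3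
    rw [mjk _ (by omega)] at h4
    have hn : max a b = n := by omega
    have h3' : max a b' ≠ n := by omega
    have h4' : max a' b ≠ n := by omega
    have := congrArg (MvPolynomial.eval (fun s : Fin R ⊕ (Fin C ⊕ ℕ) =>
      (Sum.elim (fun _ => 1) (Sum.elim (fun _ => 1) (fun m => if m = n then 0 else 1)) s : K))) heq
    simp [piCP, lik, lil, ljk, ljl, hn, h3', h4'] at this

end Paper
end

section
/- Let S_1 ⊂ S_2 ⊂ ⋯ ⊂ S_N ⊂ I be rectangles with all inclusions strict. Let Q be the additive submonoid of ℤ^{R+C+N+1} generated by the configuration vectors {a_{ij} : (i,j) ∈ I} and let G be the subgroup of ℤ^{R+C+N+1} generated by the same set. Then Q is normal: for every z ∈ G, if k·z ∈ Q for some positive integer k, then z ∈ Q. (Equivalently, the semigroup ring of the change point model is normal.) -/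
open Finset

namespace Paper

section Aux

variable {ι κ T : Type} [Fintype ι] [Fintype κ] [Fintype T] [DecidableEq ι] [DecidableEq κ]
  [LinearOrder T]

/-- Facet description of the cone. -/
structure InK (α : ι → T) (β : κ → T) (z : (ι → ℤ) × (κ → ℤ) × (T → ℤ)) : Prop where
  r0 : ∀ i, 0 ≤ z.1 i
  c0 : ∀ j, 0 ≤ z.2.1 j
  l0 : ∀ t, 0 ≤ z.2.2 t
  rl : ∑ i, z.1 i = ∑ t, z.2.2 t
  cl : ∑ j, z.2.1 j = ∑ t, z.2.2 t
  ru : ∀ t, ∑ s with s ≤ t, z.2.2 s ≤ ∑ i with α i ≤ t, z.1 i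
  cu : ∀ t, ∑ s with s ≤ t, z.2.2 s ≤ ∑ j with β j ≤ t, z.2.1 j
  sl : ∀ t, z.2.2 t ≤ ∑ i with α i = t, z.1 i + ∑ j with β j = t, z.2.1 j

/-- The generator. -/
def gen (α : ι → T) (β : κ → T) (p : ι × κ) : (ι → ℤ) × (κ → ℤ) × (T → ℤ) :=
  (Pi.single p.1 1, Pi.single p.2 1, Pi.single (max (α p.1) (β p.2)) 1)

lemma InK.of_smul {α : ι → T} {β : κ → T} {z : (ι → ℤ) × (κ → ℤ) × (T → ℤ)} {k : ℕ}
    (hk : 0 < k) (h : InK α β (k • z)) : InK α β z := by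
  have hk' : (0 : ℤ) < k := by exact_mod_cast hk
  obtain ⟨h1, h2, h3, h4, h5, h6, h7, h8⟩ := h
  simp only [Prod.smul_fst, Prod.smul_snd, Pi.smul_apply] at h1 h2 h3 h4 h5 h6 h7 h8
  simp only [nsmul_eq_mul, ← Finset.mul_sum,
    ← mul_add, mul_le_mul_iff_right₀ hk', mul_nonneg_iff_of_pos_left hk'] at h1 h2 h3 h4 h5 h6 h7 h8
  exact ⟨h1, h2, h3, mul_left_cancel₀ hk'.ne' h4, mul_left_cancel₀ hk'.ne' h5, h6, h7, h8⟩

lemma InK.add {α : ι → T} {β : κ → T} {x y : (ι → ℤ) × (κ → ℤ) × (T → ℤ)}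
    (hx : InK α β x) (hy : InK α β y) : InK α β (x + y) := by
  obtain ⟨h1, h2, h3, h4, h5, h6, h7, h8⟩ := hx
  obtain ⟨g1, g2, g3, g4, g5, g6, g7, g8⟩ := hy
  constructor <;> simp only [Prod.fst_add, Prod.snd_add, Pi.add_apply, Finset.sum_add_distrib]
  · intro i; linarith [h1 i, g1 i]
  · intro i; linarith [h2 i, g2 i]
  · intro i; linarith [h3 i, g3 i]
  · linarith
  · linarith
  · intro i; linarith [h6 i, g6 i]
  · intro i; linarith [h7 i, g7 i]
  · intro i; linarith [h8 i, g8 i]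

lemma sum_single_filter {X : Type} [Fintype X] [DecidableEq X] (P : X → Prop) [DecidablePred P]
    (x : X) : ∑ y with P y, (Pi.single x (1 : ℤ) : X → ℤ) y = if P x then 1 else 0 := by
  rw [Finset.sum_pi_single']
  simp

lemma InK.gen (α : ι → T) (β : κ → T) (p : ι × κ) : InK α β (gen α β p) := by
  constructor <;> simp only [Paper.gen, sum_single_filter]
  · intro i; by_cases h : i = p.1 <;> simp [Pi.single_apply, h]
  · intro i; by_cases h : i = p.2 <;> simp [Pi.single_apply, h]
  · intro i; simp only [Pi.single_apply]; split_ifs <;> simp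
  · simp
  · simp
  · intro t
    by_cases h : max (α p.1) (β p.2) ≤ t
    · rw [if_pos h, if_pos (le_trans (le_max_left _ _) h)]
    · rw [if_neg h]; split_ifs <;> simp
  · intro t
    by_cases h : max (α p.1) (β p.2) ≤ t
    · rw [if_pos h, if_pos (le_trans (le_max_right _ _) h)]
    · rw [if_neg h]; split_ifs <;> simp
  · intro t
    simp only [Pi.single_apply]
    rcases max_choice (α p.1) (β p.2) with h | h <;> rw [h]
    · by_cases e : t = α p.1
      · rw [if_pos e, if_pos e.symm]; split_ifs <;> simp
      · rw [if_neg e]; split_ifs <;> simp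
    · by_cases e : t = β p.2
      · rw [if_pos e, if_pos e.symm]; split_ifs <;> simp
      · rw [if_neg e]; split_ifs <;> simp

lemma InK.step {α : ι → T} {β : κ → T} {z : (ι → ℤ) × (κ → ℤ) × (T → ℤ)}
    (h : InK α β z) (n : T) (hn : 0 < z.2.2 n) (hmin : ∀ m, m < n → z.2.2 m = 0)
    (i : ι) (j : κ) (hi : 0 < z.1 i) (hj : 0 < z.2.1 j) (hmax : max (α i) (β j) = n)
    (hs : α i = n → β j = n →
      z.2.2 n < ∑ i with α i = n, z.1 i + ∑ j with β j = n, z.2.1 j) :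
    InK α β (z - Paper.gen α β (i, j)) := by
  obtain ⟨h1, h2, h3, h4, h5, h6, h7, h8⟩ := h
  have hin : α i ≤ n := hmax ▸ le_max_left _ _
  have hjn : β j ≤ n := hmax ▸ le_max_right _ _
  have k1 : ∀ i', 0 ≤ (z - Paper.gen α β (i, j)).1 i' := by
    intro i'
    simp only [Paper.gen, Prod.fst_sub, Pi.sub_apply, Pi.single_apply]
    split_ifs with hh
    · subst hh; omega
    · simpa using h1 i'
  have k2 : ∀ i', 0 ≤ (z - Paper.gen α β (i, j)).2.1 i' := by
    intro i'
    simp only [Paper.gen, Prod.fst_sub, Prod.snd_sub, Pi.sub_apply, Pi.single_apply]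
    split_ifs with hh
    · subst hh; omega
    · simpa using h2 i'
  have hz : ∀ t, t < n → ∑ s with s ≤ t, (z - Paper.gen α β (i, j)).2.2 s = 0 := by
    intro t ht
    apply Finset.sum_eq_zero
    intro s hs
    have hsn : s < n := lt_of_le_of_lt (by simpa using hs) ht
    simp [Paper.gen, hmax, hmin s hsn, Pi.single_apply, hsn.ne]
  refine ⟨k1, k2, ?_, ?_, ?_, ?_, ?_, ?_⟩
  · intro t
    simp only [Paper.gen, Prod.snd_sub, Pi.sub_apply, Pi.single_apply, hmax]
    split_ifs with hh
    · subst hh; omega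
    · simpa using h3 t
  · simp [Paper.gen, h4]
  · simp [Paper.gen, h5]
  · intro t
    rcases lt_or_ge t n with ht | ht
    · rw [hz t ht]; exact Finset.sum_nonneg fun i _ => k1 i
    · have := h6 t
      simp only [Paper.gen, Prod.fst_sub, Prod.snd_sub, Pi.sub_apply, Finset.sum_sub_distrib,
        sum_single_filter, hmax, if_pos ht, if_pos (hin.trans ht)]
      linarith
  · intro t
    rcases lt_or_ge t n with ht | ht
    · rw [hz t ht]; exact Finset.sum_nonneg fun i _ => k2 i
    · have := h7 t
      simp only [Paper.gen, Prod.fst_sub, Prod.snd_sub, Pi.sub_apply, Finset.sum_sub_distrib,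
        sum_single_filter, hmax, if_pos ht, if_pos (hjn.trans ht)]
      linarith
  · intro t
    rcases lt_trichotomy t n with ht | ht | ht
    · have e0 : (z - Paper.gen α β (i, j)).2.2 t = 0 := by
        simp [Paper.gen, hmax, hmin t ht, Pi.single_apply, ht.ne]
      rw [e0]
      exact add_nonneg (Finset.sum_nonneg fun i _ => k1 i) (Finset.sum_nonneg fun i _ => k2 i)
    · subst ht
      have := h8 t
      simp only [Paper.gen, Prod.fst_sub, Prod.snd_sub, Pi.sub_apply, Finset.sum_sub_distrib,
        sum_single_filter, hmax, Pi.single_eq_same]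
      by_cases ha : α i = t <;> by_cases hb : β j = t
      · have := hs ha hb
        simp only [ha, hb, if_true]; linarith
      · simp only [ha, hb, if_true, if_false]; linarith
      · simp only [ha, hb, if_true, if_false]; linarith
      · simp only [ha, hb, if_false]; linarith
    · have := h8 t
      have ha : α i ≠ t := (lt_of_le_of_lt hin ht).ne
      have hb : β j ≠ t := (lt_of_le_of_lt hjn ht).ne
      simp only [Paper.gen, Prod.fst_sub, Prod.snd_sub, Pi.sub_apply, Finset.sum_sub_distrib,
        sum_single_filter, hmax, Pi.single_eq_of_ne ht.ne', ha, hb, if_false]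
      linarith

lemma sum_le_split {X : Type} [Fintype X] (α : X → T) (r : X → ℤ) (n : T) :
    ∑ i with α i ≤ n, r i = ∑ i with α i < n, r i + ∑ i with α i = n, r i := by
  classical
  rw [← Finset.sum_union]
  · congr 1
    ext x
    simp [le_iff_lt_or_eq]
  · rw [Finset.disjoint_filter]
    intro x _ h1 h2
    exact h1.ne h2

lemma exists_pos_of_sum {X : Type} [Fintype X] (P : X → Prop) [DecidablePred P] (r : X → ℤ)
    (h : 0 < ∑ i with P i, r i) : ∃ i, P i ∧ 0 < r i := by
  obtain ⟨i, hi, h⟩ := Finset.exists_lt_of_sum_lt (s := univ.filter P) (f := fun _ => (0 : ℤ))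
    (g := r) (by simpa using h)
  exact ⟨i, by simpa using hi, h⟩

lemma InK.exists_step {α : ι → T} {β : κ → T} {z : (ι → ℤ) × (κ → ℤ) × (T → ℤ)}
    (h : InK α β z) (n : T) (hn : 0 < z.2.2 n) (hmin : ∀ m, m < n → z.2.2 m = 0) :
    ∃ p, InK α β (z - Paper.gen α β p) := by
  have hle : z.2.2 n ≤ ∑ s with s ≤ n, z.2.2 s :=
    Finset.single_le_sum (f := z.2.2) (fun s _ => h.l0 s) (by simp)
  have hr := hle.trans (h.ru n)
  have hc := hle.trans (h.cu n)
  rw [sum_le_split] at hr hc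
  have hs := h.sl n
  have p1 : 0 ≤ ∑ i with α i < n, z.1 i := Finset.sum_nonneg fun i _ => h.r0 i
  have p2 : 0 ≤ ∑ i with α i = n, z.1 i := Finset.sum_nonneg fun i _ => h.r0 i
  have p3 : 0 ≤ ∑ i with β i < n, z.2.1 i := Finset.sum_nonneg fun i _ => h.c0 i
  have p4 : 0 ≤ ∑ i with β i = n, z.2.1 i := Finset.sum_nonneg fun i _ => h.c0 i
  by_cases hA : 0 < ∑ i with α i = n, z.1 i
  · obtain ⟨i, hi, hi'⟩ := exists_pos_of_sum _ _ hA
    by_cases hB : 0 < ∑ i with β i < n, z.2.1 i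
    · obtain ⟨j, hj, hj'⟩ := exists_pos_of_sum _ _ hB
      refine ⟨(i, j), h.step n hn hmin i j hi' hj' ?_ ?_⟩
      · rw [hi]; exact max_eq_left hj.le
      · intro _ h2; exact absurd h2 hj.ne
    · have hB' : 0 < ∑ i with β i = n, z.2.1 i := by linarith
      obtain ⟨j, hj, hj'⟩ := exists_pos_of_sum _ _ hB'
      refine ⟨(i, j), h.step n hn hmin i j hi' hj' ?_ ?_⟩
      · rw [hi, hj, max_self]
      · intro _ _; linarith
  · have hB : 0 < ∑ i with β i = n, z.2.1 i := by linarith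
    have hA' : 0 < ∑ i with α i < n, z.1 i := by linarith
    obtain ⟨i, hi, hi'⟩ := exists_pos_of_sum _ _ hA'
    obtain ⟨j, hj, hj'⟩ := exists_pos_of_sum _ _ hB
    refine ⟨(i, j), h.step n hn hmin i j hi' hj' ?_ ?_⟩
    · rw [hj]; exact max_eq_right hi.le
    · intro h2; exact absurd h2 hi.ne

lemma InK.mem {α : ι → T} {β : κ → T} (d : ℕ) : ∀ {z : (ι → ℤ) × (κ → ℤ) × (T → ℤ)},
    InK α β z → ∑ t, z.2.2 t = d → z ∈ AddSubmonoid.closure (Set.range (Paper.gen α β)) := by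
  induction d with
  | zero =>
    intro z h hd
    have e1 : z.1 = 0 := by
      have := h.rl.trans hd
      rw [Nat.cast_zero, Finset.sum_eq_zero_iff_of_nonneg fun i _ => h.r0 i] at this
      ext i; exact this i (by simp)
    have e2 : z.2.1 = 0 := by
      have := h.cl.trans hd
      rw [Nat.cast_zero, Finset.sum_eq_zero_iff_of_nonneg fun i _ => h.c0 i] at this
      ext i; exact this i (by simp)
    have e3 : z.2.2 = 0 := by
      rw [Nat.cast_zero, Finset.sum_eq_zero_iff_of_nonneg fun i _ => h.l0 i] at hd
      ext i; exact hd i (by simp)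
    have : z = 0 := Prod.ext e1 (Prod.ext e2 e3)
    rw [this]; exact zero_mem _
  | succ d ih =>
    intro z h hd
    have hpos : 0 < ∑ t, z.2.2 t := by rw [hd]; positivity
    obtain ⟨t, -, ht⟩ := exists_pos_of_sum (fun _ : T => True) z.2.2 (by simpa using hpos)
    have hne : (univ.filter fun t => 0 < z.2.2 t).Nonempty := ⟨t, by simpa using ht⟩
    have hm := Finset.min'_mem _ hne
    have hm2 := fun m => Finset.min'_le (univ.filter fun t => 0 < z.2.2 t) m
    set n := Finset.min' _ hne
    obtain ⟨p, hp⟩ := h.exists_step n (by simpa using hm) (by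
      intro m hmn
      by_contra hcon
      have : 0 < z.2.2 m := lt_of_le_of_ne (h.l0 m) (Ne.symm hcon)
      exact absurd (hm2 m (by simpa using this)) (not_le.mpr hmn))
    have := ih hp (by simp [Paper.gen, hd])
    have h2 := add_mem this (AddSubmonoid.subset_closure (Set.mem_range_self (f := Paper.gen α β) p))
    simpa using h2

lemma gen_normal (α : ι → T) (β : κ → T) (z : (ι → ℤ) × (κ → ℤ) × (T → ℤ)) (k : ℕ) (hk : 0 < k)
    (h : k • z ∈ AddSubmonoid.closure (Set.range (Paper.gen α β))) :
    z ∈ AddSubmonoid.closure (Set.range (Paper.gen α β)) := by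
  have hK : InK α β (k • z) := by
    generalize k • z = w at h
    induction h using AddSubmonoid.closure_induction with
    | mem x hx => obtain ⟨p, rfl⟩ := hx; exact InK.gen α β p
    | zero => constructor <;> simp
    | add x y _ _ hx hy => exact hx.add hy
  have hz := hK.of_smul hk
  exact hz.mem (∑ t, z.2.2 t).toNat
    (by rw [Int.toNat_of_nonneg (Finset.sum_nonneg fun t _ => hz.l0 t)])

end Aux

lemma exists_types (R C N : ℕ) (hN : 1 ≤ N)
    (S : ℕ → Finset (Fin R × Fin C)) (hS0 : S 0 = ∅) (hStop : S (N + 1) = Finset.univ)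
    (hrect : ∀ n, 1 ≤ n → n ≤ N → IsRectangle (S n))
    (hchain : ∀ n m, 1 ≤ n → n < m → m ≤ N → S n ⊂ S m) :
    ∃ (α : Fin R → Fin (N + 1)) (β : Fin C → Fin (N + 1)),
      ∀ p (n : Fin (N + 1)), p ∈ S (n.1 + 1) ↔ α p.1 ≤ n ∧ β p.2 ≤ n := by
  obtain ⟨i0, -, j0, -, -, -, -⟩ := hrect 1 le_rfl hN
  have hmono : ∀ n m : Fin (N + 1), n ≤ m → S (n.1 + 1) ⊆ S (m.1 + 1) := by
    intro n m hnm
    rcases hnm.eq_or_lt with h | h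
    · rw [h]
    · by_cases hm : m.1 + 1 ≤ N
      · exact (hchain _ _ (by omega) (by omega) hm).subset
      · have : m.1 + 1 = N + 1 := by omega
        rw [this, hStop]; exact subset_univ _
  have hprod : ∀ n : Fin (N + 1), ∀ i j, (i, j) ∈ S (n.1 + 1) ↔
      (∃ j', (i, j') ∈ S (n.1 + 1)) ∧ ∃ i', (i', j) ∈ S (n.1 + 1) := by
    intro n i j
    refine ⟨fun h => ⟨⟨j, h⟩, ⟨i, h⟩⟩, ?_⟩
    rintro ⟨⟨j', hj⟩, ⟨i', hi⟩⟩
    by_cases hn : n.1 + 1 ≤ N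
    · obtain ⟨a1, a2, b1, b2, -, -, hS⟩ := hrect _ (by omega) hn
      rw [hS] at hi hj ⊢
      simp only [mem_filter, mem_univ, true_and] at hi hj ⊢
      tauto
    · have : n.1 + 1 = N + 1 := by omega
      rw [this, hStop]; exact mem_univ _
  have key : ∀ {X : Type} (A : Fin (N + 1) → X → Prop)
      (_ : ∀ n m, n ≤ m → ∀ x, A n x → A m x) (_ : ∀ x, A (Fin.last N) x),
      ∃ α : X → Fin (N + 1), ∀ x n, A n x ↔ α x ≤ n := by
    classical
    intro X A hA hl
    have : ∀ x, ∃ t, ∀ n, A n x ↔ t ≤ n := by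
      intro x
      have hne : (univ.filter fun t => A t x).Nonempty := ⟨Fin.last N, by simpa using hl x⟩
      refine ⟨Finset.min' _ hne, fun n => ⟨fun h => Finset.min'_le _ _ (by simpa using h), ?_⟩⟩
      intro h
      exact hA _ _ h x (by simpa using Finset.min'_mem _ hne)
    choose α hα using this
    exact ⟨α, hα⟩
  obtain ⟨α, hα⟩ := key (fun n i => ∃ j', (i, j') ∈ S (n.1 + 1))
    (fun n m h x ⟨j, hj⟩ => ⟨j, hmono n m h hj⟩) (fun x => ⟨j0, by simp [hStop]⟩)
  obtain ⟨β, hβ⟩ := key (fun n j => ∃ i', (i', j) ∈ S (n.1 + 1))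
    (fun n m h x ⟨j, hj⟩ => ⟨j, hmono n m h hj⟩) (fun x => ⟨i0, by simp [hStop]⟩)
  exact ⟨α, β, fun p n => by rw [← hα, ← hβ]; exact hprod n p.1 p.2⟩

/-- the affine semigroup generated by the configuration vectors of the
change point model is normal. -/
theorem changePoint_semigroup_normal (R C N : ℕ) (hN : 1 ≤ N)
    (S : ℕ → Finset (Fin R × Fin C)) (hS0 : S 0 = ∅) (hStop : S (N + 1) = Finset.univ)
    (hrect : ∀ n, 1 ≤ n → n ≤ N → IsRectangle (S n))
    (hchain : ∀ n m, 1 ≤ n → n < m → m ≤ N → S n ⊂ S m)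
    (htop : S N ⊂ Finset.univ)
    (lev : Fin R × Fin C → ℕ)
    (hlev : ∀ p n, 1 ≤ n → n ≤ N + 1 → (lev p = n ↔ p ∈ S n ∧ p ∉ S (n - 1)))
    (a : Fin R × Fin C → (Fin R → ℤ) × (Fin C → ℤ) × (Fin (N + 1) → ℤ))
    (ha : ∀ p, a p = (Pi.single p.1 1, Pi.single p.2 1,
      fun m : Fin (N + 1) => if m.1 + 1 = lev p then 1 else 0)) :
    ∀ z ∈ AddSubgroup.closure (Set.range a),
      (∃ k : ℕ, 0 < k ∧ k • z ∈ AddSubmonoid.closure (Set.range a)) →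
        z ∈ AddSubmonoid.closure (Set.range a) := by
  obtain ⟨α, β, hαβ⟩ := exists_types R C N hN S hS0 hStop hrect hchain
  have hl : ∀ p, lev p = (max (α p.1) (β p.2)).1 + 1 := by
    intro p
    set n := max (α p.1) (β p.2) with hn
    rw [hlev p _ (by omega) (by omega)]
    refine ⟨(hαβ p n).2 ⟨le_max_left _ _, le_max_right _ _⟩, ?_⟩
    rw [Nat.add_sub_cancel]
    by_cases h0 : n.1 = 0
    · rw [h0, hS0]; simp
    · have e : n.1 = (⟨n.1 - 1, by omega⟩ : Fin (N + 1)).1 + 1 := by simp; omega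
      rw [e, hαβ, ← max_le_iff, ← hn, Fin.le_def]
      change ¬ (n.1 ≤ n.1 - 1)
      omega
  have hag : a = gen α β := by
    funext p
    rw [ha, gen]
    congr 2
    funext m
    rw [hl, Pi.single_apply]
    simp [Fin.ext_iff]
  subst hag
  rintro z - ⟨k, hk, h⟩
  exact gen_normal α β z k hk h

end Paper
end
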